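/- arXiv:2201.04760 — 5 statements merged into one kernel-verified Lean document; each statement's English description precedes it below -/
import Mathlib

section
/- Let G be a finite group. If the average order o(G) is strictly less than 31/12, then G is supersolvable. -/
/-- The sum of the orders of all elements of `G`. -/
noncomputable def psi (G : Type*) [Group G] : ℕ := ∑ᶠ x : G, orderOf x

/-- The average order of a finite group `G`, as a rational number. -/
noncomputable def avgOrder (G : Type*) [Group G] : ℚ := psi G / Nat.card G

/-- The number of elements of order `d` in `G`. -/
noncomputable def nOrd (G : Type*) [Group G] (d : ℕ) : ℕ := Nat.card {x : G // orderOf x = d}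

/-- A group is supersolvable if it has a chain of subgroups
`⊥ = H 0 ≤ H 1 ≤ … ≤ H n = ⊤`, each normal in `G`, with all successive
quotients cyclic. -/
def IsSupersolvable (G : Type*) [Group G] : Prop :=
  ∃ (n : ℕ) (H : Fin (n + 1) → Subgroup G) (hnorm : ∀ i, (H i).Normal),
    H 0 = ⊥ ∧ H (Fin.last n) = ⊤ ∧
    (∀ i : Fin n, H i.castSucc ≤ H i.succ) ∧
    ∀ i : Fin n,
      letI := (hnorm i.castSucc).subgroupOf (H i.succ)
      IsCyclic (↥(H i.succ) ⧸ (H i.castSucc).subgroupOf (H i.succ))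


theorem isCyclic_quotient_subgroupOf_iff {G : Type*} [Group G] (K L : Subgroup G)
    [(L.subgroupOf K).Normal] :
    IsCyclic (K ⧸ L.subgroupOf K) ↔ ∃ g ∈ K, ∀ x ∈ K, ∃ n : ℤ, (g ^ n)⁻¹ * x ∈ L := by
  constructor
  · rintro ⟨q, hq⟩
    obtain ⟨g, rfl⟩ := QuotientGroup.mk_surjective q
    refine ⟨g, g.2, fun x hx => ?_⟩
    obtain ⟨n, hn⟩ := Subgroup.mem_zpowers_iff.1 (hq (QuotientGroup.mk ⟨x, hx⟩))
    rw [← QuotientGroup.mk_zpow, QuotientGroup.eq] at hn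
    exact ⟨n, by simpa [Subgroup.mem_subgroupOf] using hn⟩
  · rintro ⟨g, hg, h⟩
    refine ⟨QuotientGroup.mk ⟨g, hg⟩, fun q => ?_⟩
    obtain ⟨x, rfl⟩ := QuotientGroup.mk_surjective q
    obtain ⟨n, hn⟩ := h x x.2
    refine Subgroup.mem_zpowers_iff.2 ⟨n, ?_⟩
    rw [← QuotientGroup.mk_zpow, QuotientGroup.eq]
    simpa [Subgroup.mem_subgroupOf] using hn

theorem IsSupersolvable.of_subsingleton (G : Type*) [Group G] [Subsingleton G] :
    IsSupersolvable G :=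
  ⟨0, fun _ => ⊥, fun _ => inferInstance, rfl, Subsingleton.elim _ _, fun i => i.elim0,
    fun i => i.elim0⟩

theorem IsSupersolvable.of_quotient_zpowers {G : Type*} [Group G] (z : G)
    [hz : (Subgroup.zpowers z).Normal] (h : IsSupersolvable (G ⧸ Subgroup.zpowers z)) :
    IsSupersolvable G := by
  obtain ⟨n, H, hnorm, h0, h1, hle, hcyc⟩ := h
  let π := QuotientGroup.mk' (Subgroup.zpowers z)
  have hπ : Function.Surjective π := QuotientGroup.mk'_surjective _
  have hK : ∀ i, (Fin.cons ⊥ (fun i => (H i).comap π) : Fin (n + 2) → Subgroup G) i |>.Normal := by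
    intro i
    refine Fin.cases ?_ (fun j => ?_) i
    · simp only [Fin.cons_zero]; infer_instance
    · simpa using (hnorm j).comap π
  have hker : (⊥ : Subgroup (G ⧸ Subgroup.zpowers z)).comap π = Subgroup.zpowers z := by
    rw [MonoidHom.comap_bot, QuotientGroup.ker_mk']
  refine ⟨n + 1, Fin.cons ⊥ (fun i => (H i).comap π), hK, rfl, ?_, ?_, ?_⟩
  · rw [← Fin.succ_last, Fin.cons_succ, h1, Subgroup.comap_top]
  · intro i
    refine Fin.cases ?_ (fun j => ?_) i
    · simp
    · rw [← Fin.succ_castSucc, Fin.cons_succ, Fin.cons_succ]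
      exact Subgroup.comap_mono (hle j)
  · intro i
    have := (hK i.castSucc).subgroupOf
      ((Fin.cons ⊥ (fun i => (H i).comap π) : Fin (n + 2) → Subgroup G) i.succ)
    refine (isCyclic_quotient_subgroupOf_iff _ _).2 ?_
    clear this
    refine Fin.cases ?_ (fun j => ?_) i
    · rw [Fin.castSucc_zero, Fin.cons_zero, Fin.cons_succ, h0, hker]
      refine ⟨z, Subgroup.mem_zpowers z, fun x hx => ?_⟩
      obtain ⟨m, rfl⟩ := Subgroup.mem_zpowers_iff.1 hx
      exact ⟨m, by simp⟩
    · rw [← Fin.succ_castSucc, Fin.cons_succ, Fin.cons_succ]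
      have := (hnorm j.castSucc).subgroupOf (H j.succ)
      obtain ⟨q, hq, hx⟩ := (isCyclic_quotient_subgroupOf_iff _ _).1 (hcyc j)
      obtain ⟨g, rfl⟩ := hπ q
      refine ⟨g, hq, fun x hxm => ?_⟩
      obtain ⟨m, hm⟩ := hx (π x) hxm
      exact ⟨m, by simpa [Subgroup.mem_comap] using hm⟩

theorem psi_eq_sum (G : Type*) [Group G] [Fintype G] : psi G = ∑ x : G, orderOf x :=
  finsum_eq_sum_of_fintype _

theorem avgOrder_lt_iff (G : Type*) [Group G] [Finite G] :
    avgOrder G < 31 / 12 ↔ 12 * psi G < 31 * Nat.card G := by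
  have : (0 : ℚ) < Nat.card G := by exact_mod_cast Nat.card_pos
  rw [avgOrder, div_lt_iff₀ this, ← Nat.cast_lt (α := ℚ)]
  push_cast
  constructor <;> intro h <;> linarith

theorem card_mul_psi_quotient_le {G : Type*} [Group G] [Finite G] (M : Subgroup G) [M.Normal] :
    Nat.card M * psi (G ⧸ M) ≤ psi G := by
  classical
  have := Fintype.ofFinite G
  have : Fintype (G ⧸ M) := Fintype.ofFinite _
  rw [psi_eq_sum, psi_eq_sum, ← Finset.sum_fiberwise (s := Finset.univ)
    (g := fun x : G => (x : G ⧸ M)), Finset.mul_sum]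
  refine Finset.sum_le_sum fun q _ => ?_
  have hcard : (Finset.univ.filter fun x : G => (x : G ⧸ M) = q).card = Nat.card M := by
    have := QuotientGroup.card_preimage_mk M {q}
    rw [Nat.card_unique (α := ({q} : Set (G ⧸ M))), mul_one] at this
    rw [← this]
    exact (Nat.subtype_card _ (by simp)).symm
  rw [← hcard, ← smul_eq_mul]
  refine Finset.card_nsmul_le_sum _ _ _ fun x hx => ?_
  rw [← (Finset.mem_filter.1 hx).2]
  exact Nat.le_of_dvd (orderOf_pos x) (orderOf_map_dvd (QuotientGroup.mk' M) x)

theorem psi_quotient_bound {G : Type*} [Group G] [Finite G] (M : Subgroup G) [M.Normal]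
    (h : 12 * psi G < 31 * Nat.card G) : 12 * psi (G ⧸ M) < 31 * Nat.card (G ⧸ M) := by
  have h1 := card_mul_psi_quotient_le M
  rw [Subgroup.card_eq_card_quotient_mul_card_subgroup M] at h
  have : 0 < Nat.card M := Nat.card_pos
  refine lt_of_mul_lt_mul_left (a := Nat.card M) ?_ this.le
  linarith

/-- The class of finite groups with `o(G) < 31/12` is closed under quotients, so it consists of
supersolvable groups as soon as each nontrivial member has a nontrivial cyclic normal subgroup. -/
theorem isSupersolvable_of_exists_zpowers_normal.{u}
    (H : ∀ (G : Type u) [Group G] [Finite G] [Nontrivial G], 12 * psi G < 31 * Nat.card G →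
      ∃ z : G, z ≠ 1 ∧ (Subgroup.zpowers z).Normal)
    (G : Type u) [Group G] [Finite G] (h : 12 * psi G < 31 * Nat.card G) : IsSupersolvable G := by
  induction hn : Nat.card G using Nat.strong_induction_on generalizing G with
  | _ n ih =>
    rcases subsingleton_or_nontrivial G with _ | _
    · exact .of_subsingleton G
    obtain ⟨z, hz, hzn⟩ := H G h
    refine .of_quotient_zpowers z (ih _ ?_ _ (psi_quotient_bound _ h) rfl)
    have h1 := Subgroup.card_eq_card_quotient_mul_card_subgroup (Subgroup.zpowers z)
    have h2 : 1 < Nat.card (Subgroup.zpowers z) := by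
      rw [Subgroup.one_lt_card_iff_ne_bot]
      simpa using hz
    have h3 : 0 < Nat.card (G ⧸ Subgroup.zpowers z) := Nat.card_pos
    nlinarith

theorem sum_coset_bound {G : Type*} [Group G] [Fintype G] (t : G) {Z C D : Subgroup G}
    (hZC : Z ≤ C) (hCD : C ≤ D) (f : G → ℕ) (α β γ δ : ℕ)
    (hα : ∀ x ∈ Z, α ≤ f x + f (x * t) + f (x * t ^ 2))
    (hβ : ∀ x ∈ C, x ∉ Z → β ≤ f x + f (x * t) + f (x * t ^ 2))
    (hγ : ∀ x ∈ D, x ∉ C → γ ≤ f x + f (x * t) + f (x * t ^ 2))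
    (hδ : ∀ x ∉ D, δ ≤ f x + f (x * t) + f (x * t ^ 2)) :
    (δ : ℤ) * Nat.card G + (γ - δ) * Nat.card D + (β - γ) * Nat.card C + (α - β) * Nat.card Z ≤
      3 * ((∑ x, f x : ℕ) : ℤ) := by
  classical
  have hF : 3 * ∑ x, f x = ∑ x, (f x + f (x * t) + f (x * t ^ 2)) := by
    have h1 : ∑ x, f (x * t) = ∑ x, f x := Equiv.sum_comp (Equiv.mulRight t) f
    have h2 : ∑ x, f (x * t ^ 2) = ∑ x, f x := Equiv.sum_comp (Equiv.mulRight (t ^ 2)) f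
    rw [Finset.sum_add_distrib, Finset.sum_add_distrib, h1, h2]
    ring
  have hind (K : Subgroup G) : ∑ x : G, (if x ∈ K then (1 : ℤ) else 0) = Nat.card K := by
    rw [Finset.sum_boole]
    exact congrArg _ (Nat.subtype_card _ (by simp)).symm
  have hL : ∑ x : G, ((δ : ℤ) + (γ - δ) * (if x ∈ D then 1 else 0)
      + (β - γ) * (if x ∈ C then 1 else 0) + (α - β) * (if x ∈ Z then 1 else 0)) =
      δ * Nat.card G + (γ - δ) * Nat.card D + (β - γ) * Nat.card C + (α - β) * Nat.card Z := by
    simp only [Finset.sum_add_distrib, ← Finset.mul_sum, hind, Finset.sum_const, Finset.card_univ,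
      Nat.card_eq_fintype_card, nsmul_eq_mul, mul_comm]
  have h3 : (3 : ℤ) * ((∑ x, f x : ℕ) : ℤ) =
      ∑ x, ((f x + f (x * t) + f (x * t ^ 2) : ℕ) : ℤ) := by
    rw [← Nat.cast_sum, ← hF]
    push_cast
    rfl
  rw [← hL, h3]
  refine Finset.sum_le_sum fun x _ => ?_
  by_cases hZ : x ∈ Z
  · have := hα x hZ
    simp only [hZ, hZC hZ, hCD (hZC hZ), if_true]
    lia
  by_cases hC : x ∈ C
  · have := hβ x hC hZ
    simp only [hZ, hC, hCD hC, if_true, if_false]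
    lia
  by_cases hD : x ∈ D
  · have := hγ x hD hC
    simp only [hZ, hC, hD, if_true, if_false]
    lia
  · have := hδ x hD
    simp only [hZ, hC, hD, if_false]
    lia

theorem le_orderOf_of_pow_ne_one {G : Type*} [Group G] [Finite G] {x : G} {n : ℕ}
    (h : ∀ m, 0 < m → m < n → x ^ m ≠ 1) : n ≤ orderOf x := by
  by_contra! hlt
  exact h _ (orderOf_pos x) hlt (pow_orderOf_eq_one x)

theorem two_le_orderOf {G : Type*} [Group G] [Finite G] {x : G} (h : x ≠ 1) : 2 ≤ orderOf x :=
  le_orderOf_of_pow_ne_one fun m h0 h1 => by interval_cases m; simpa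

theorem three_le_orderOf {G : Type*} [Group G] [Finite G] {x : G} (h2 : x ^ 2 ≠ 1) :
    3 ≤ orderOf x :=
  le_orderOf_of_pow_ne_one fun m h0 h1 => by
    interval_cases m
    · rintro h
      rw [pow_one] at h
      simp [h] at h2
    · exact h2

theorem four_le_orderOf {G : Type*} [Group G] [Finite G] {x : G} (h2 : x ^ 2 ≠ 1)
    (h3 : x ^ 3 ≠ 1) : 4 ≤ orderOf x :=
  le_orderOf_of_pow_ne_one fun m h0 h1 => by
    interval_cases m
    · rintro h
      rw [pow_one] at h
      simp [h] at h2
    · exact h2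
    · exact h3

section OrderThree

variable {G : Type*} [Group G] {t : G}

theorem sq_eq_inv_of_orderOf_eq_three (ht : orderOf t = 3) : t ^ 2 = t⁻¹ := by
  rw [eq_inv_iff_mul_eq_one, ← pow_succ, ← orderOf_dvd_iff_pow_eq_one, ht]

theorem sq_ne_one_of_orderOf_eq_three (ht : orderOf t = 3) : t ^ 2 ≠ 1 := fun h => by
  have := orderOf_dvd_of_pow_eq_one h
  rw [ht] at this
  lia

theorem ne_inv_of_orderOf_eq_three (ht : orderOf t = 3) : t ≠ t⁻¹ := fun h =>
  sq_ne_one_of_orderOf_eq_three ht (by rw [sq]; exact mul_eq_one_iff_eq_inv.2 h)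

theorem ne_one_of_orderOf_eq_three (ht : orderOf t = 3) : t ≠ 1 := fun h =>
  sq_ne_one_of_orderOf_eq_three ht (by simp [h])

theorem mem_zpowers_iff_of_orderOf_eq_three (ht : orderOf t = 3) {x : G} :
    x ∈ Subgroup.zpowers t ↔ x = 1 ∨ x = t ∨ x = t⁻¹ := by
  classical
  have hf : IsOfFinOrder t := orderOf_pos_iff.1 (by lia)
  rw [hf.mem_zpowers_iff_mem_range_orderOf, ht, ← sq_eq_inv_of_orderOf_eq_three ht]
  simp only [Finset.mem_image, Finset.mem_range]
  constructor
  · rintro ⟨i, hi, rfl⟩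
    interval_cases i <;> simp
  · rintro (rfl | rfl | rfl)
    · exact ⟨0, by simp⟩
    · exact ⟨1, by simp⟩
    · exact ⟨2, by simp⟩

theorem mem_normalizer_zpowers_iff (ht : orderOf t = 3) {g : G} :
    g ∈ Subgroup.normalizer (Subgroup.zpowers t : Set G) ↔
      g * t * g⁻¹ = t ∨ g * t * g⁻¹ = t⁻¹ := by
  constructor
  · intro h
    have := (Subgroup.mem_normalizer_iff.1 h t).1 (Subgroup.mem_zpowers t)
    rcases (mem_zpowers_iff_of_orderOf_eq_three ht).1 this with h | h
    · exact absurd (conj_eq_one_iff.1 h) (ne_one_of_orderOf_eq_three ht)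
    · exact h
  · intro h
    rw [Subgroup.mem_normalizer_iff_map_conj_eq, MonoidHom.map_zpowers]
    simp only [MonoidHom.coe_coe, MulAut.conj_apply]
    rcases h with h | h <;> rw [h]
    exact Subgroup.zpowers_inv

theorem mem_centralizer_iff_conj {g : G} :
    g ∈ Subgroup.centralizer {t} ↔ g * t * g⁻¹ = t := by
  rw [Subgroup.mem_centralizer_singleton_iff, mul_inv_eq_iff_eq_mul]

theorem zpowers_le_centralizer : Subgroup.zpowers t ≤ Subgroup.centralizer {t} := by
  rw [Subgroup.zpowers_le, mem_centralizer_iff_conj, mul_inv_cancel_right]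

theorem centralizer_le_normalizer (ht : orderOf t = 3) :
    Subgroup.centralizer {t} ≤ Subgroup.normalizer (Subgroup.zpowers t : Set G) := fun _ h =>
  (mem_normalizer_zpowers_iff ht).2 (.inl (mem_centralizer_iff_conj.1 h))

theorem conj_eq_inv_of_sq_eq_one {a s : G} (h1 : a ^ 2 = 1) (h2 : (a * s) ^ 2 = 1) :
    a * s * a⁻¹ = s⁻¹ := by
  have h3 : a⁻¹ = a := by rw [inv_eq_iff_mul_eq_one, ← sq, h1]
  rw [h3, eq_inv_iff_mul_eq_one]
  simpa [sq, mul_assoc] using h2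

theorem seven_le_of_mem_zpowers (ht : orderOf t = 3) {x : G} (hx : x ∈ Subgroup.zpowers t) :
    7 ≤ orderOf x + orderOf (x * t) + orderOf (x * t ^ 2) := by
  rw [sq_eq_inv_of_orderOf_eq_three ht]
  have h3 : t * t = t⁻¹ := by rw [← sq, sq_eq_inv_of_orderOf_eq_three ht]
  have h4 : t⁻¹ * t⁻¹ = t := by rw [← mul_inv_rev, h3, inv_inv]
  rcases (mem_zpowers_iff_of_orderOf_eq_three ht).1 hx with rfl | rfl | rfl <;>
    simp [h3, h4, ht]

theorem mul_ne_one_of_notMem_zpowers {x : G} (hx : x ∉ Subgroup.zpowers t) :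
    x ≠ 1 ∧ x * t ≠ 1 ∧ x * t ^ 2 ≠ 1 := by
  refine ⟨?_, ?_, ?_⟩ <;> intro h <;> apply hx
  · exact h ▸ one_mem _
  · rw [mul_eq_one_iff_eq_inv.1 h]
    exact inv_mem (Subgroup.mem_zpowers t)
  · rw [mul_eq_one_iff_eq_inv.1 h]
    exact inv_mem (pow_mem (Subgroup.mem_zpowers t) 2)

theorem six_le_of_notMem_zpowers [Finite G] {x : G} (hx : x ∉ Subgroup.zpowers t) :
    6 ≤ orderOf x + orderOf (x * t) + orderOf (x * t ^ 2) := by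
  obtain ⟨h0, h1, h2⟩ := mul_ne_one_of_notMem_zpowers hx
  have := two_le_orderOf h0
  have := two_le_orderOf h1
  have := two_le_orderOf h2
  lia

theorem nine_le_of_mem_centralizer [Finite G] (ht : orderOf t = 3) {x : G}
    (hx : x ∈ Subgroup.centralizer {t}) (hx' : x ∉ Subgroup.zpowers t) :
    9 ≤ orderOf x + orderOf (x * t) + orderOf (x * t ^ 2) := by
  obtain ⟨h0, h1, h2⟩ := mul_ne_one_of_notMem_zpowers hx'
  have h3 : t ^ 3 = 1 := by rw [← ht, pow_orderOf_eq_one]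
  have key : ∀ a s : G, Commute a s → s ^ 2 ≠ 1 → s ^ 3 = 1 → a ≠ 1 → a ^ 2 = 1 →
      4 ≤ orderOf (a * s) := by
    intro a s hc hs hs3 ha ha2
    refine four_le_orderOf ?_ ?_
    · rwa [hc.mul_pow, ha2, one_mul]
    · rwa [hc.mul_pow, hs3, mul_one, pow_succ, ha2, one_mul]
  have hc : Commute x t := Subgroup.mem_centralizer_singleton_iff.1 hx
  have ht2 := sq_ne_one_of_orderOf_eq_three ht
  have ht4 : (t ^ 2) ^ 2 ≠ 1 := by
    rw [← pow_mul, show 2 * 2 = 3 + 1 from rfl, pow_succ, h3, one_mul]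
    exact ne_one_of_orderOf_eq_three ht
  have ht6 : (t ^ 2) ^ 3 = 1 := by rw [← pow_mul, mul_comm, pow_mul, h3, one_pow]
  have ha := two_le_orderOf h0
  have hb := two_le_orderOf h1
  have hd := two_le_orderOf h2
  have e1 : x * t * t = x * t ^ 2 := by rw [sq, mul_assoc]
  have e2 : x * t * t ^ 2 = x := by rw [mul_assoc, ← pow_succ', h3, mul_one]
  have e3 : x * t ^ 2 * t = x := by rw [mul_assoc, ← pow_succ, h3, mul_one]
  have e4 : x * t ^ 2 * t ^ 2 = x * t := by
    rw [mul_assoc, ← pow_add, show 2 + 2 = 3 + 1 from rfl, pow_succ, h3, one_mul]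
  have hct : Commute (x * t) t := hc.mul_left (.refl t)
  have hct2 : Commute (x * t ^ 2) t := hc.mul_left ((Commute.refl t).pow_left 2)
  by_cases h : x ^ 2 = 1
  · have := key x t hc ht2 h3 h0 h
    have := key x _ (hc.pow_right 2) ht4 ht6 h0 h
    lia
  by_cases h' : (x * t) ^ 2 = 1
  · have := key _ t hct ht2 h3 h1 h'
    have := key _ _ (hct.pow_right 2) ht4 ht6 h1 h'
    rw [e1] at *
    rw [e2] at *
    lia
  by_cases h'' : (x * t ^ 2) ^ 2 = 1
  · have := key _ t hct2 ht2 h3 h2 h''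
    have := key _ _ (hct2.pow_right 2) ht4 ht6 h2 h''
    rw [e3] at *
    rw [e4] at *
    lia
  have := three_le_orderOf h
  have := three_le_orderOf h'
  have := three_le_orderOf h''
  lia

/-- A left coset of `⟨t⟩` outside the normalizer of `⟨t⟩` has at most one element of
square one. -/
theorem sq_ne_one_of_notMem_normalizer (ht : orderOf t = 3) {x : G}
    (hx : x ∉ Subgroup.normalizer (Subgroup.zpowers t : Set G)) :
    ((x * t) ^ 2 ≠ 1 ∧ (x * t ^ 2) ^ 2 ≠ 1) ∨ (x ^ 2 ≠ 1 ∧ (x * t ^ 2) ^ 2 ≠ 1) ∨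
      (x ^ 2 ≠ 1 ∧ (x * t) ^ 2 ≠ 1) := by
  have htm : t ∈ Subgroup.normalizer (Subgroup.zpowers t : Set G) :=
    Subgroup.le_normalizer (Subgroup.mem_zpowers t)
  have key : ∀ a : G, a ∉ Subgroup.normalizer (Subgroup.zpowers t : Set G) →
      a ^ 2 = 1 → (a * t) ^ 2 ≠ 1 ∧ (a * t ^ 2) ^ 2 ≠ 1 := by
    intro a ha h1
    refine ⟨fun h2 => ha ?_, fun h2 => ha ?_⟩ <;> rw [mem_normalizer_zpowers_iff ht]
    · exact .inr (conj_eq_inv_of_sq_eq_one h1 h2)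
    · have := conj_eq_inv_of_sq_eq_one h1 h2
      rw [sq_eq_inv_of_orderOf_eq_three ht, ← conj_inv, inv_inj] at this
      exact .inr this
  by_cases h : x ^ 2 = 1
  · exact .inl (key x hx h)
  by_cases h' : (x * t) ^ 2 = 1
  · have := (key (x * t) (by rwa [Subgroup.mul_mem_cancel_right _ htm]) h').1
    rw [mul_assoc, ← sq] at this
    exact .inr (.inl ⟨h, this⟩)
  · exact .inr (.inr ⟨h, h'⟩)

theorem notMem_zpowers_of_notMem_normalizer {x : G}
    (hx : x ∉ Subgroup.normalizer (Subgroup.zpowers t : Set G)) : x ∉ Subgroup.zpowers t :=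
  fun h => hx (Subgroup.le_normalizer h)

theorem eight_le_of_notMem_normalizer [Finite G] (ht : orderOf t = 3) {x : G}
    (hx : x ∉ Subgroup.normalizer (Subgroup.zpowers t : Set G)) :
    8 ≤ orderOf x + orderOf (x * t) + orderOf (x * t ^ 2) := by
  obtain ⟨h0, h1, h2⟩ := mul_ne_one_of_notMem_zpowers (notMem_zpowers_of_notMem_normalizer hx)
  have := two_le_orderOf h0
  have := two_le_orderOf h1
  have := two_le_orderOf h2
  rcases sq_ne_one_of_notMem_normalizer ht hx with ⟨h, h'⟩ | ⟨h, h'⟩ | ⟨h, h'⟩ <;>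
  · have := three_le_orderOf h
    have := three_le_orderOf h'
    lia

theorem psi_coset_bound [Finite G] (ht : orderOf t = 3) :
    8 * Nat.card G + 3 * Nat.card (Subgroup.centralizer {t}) ≤
      3 * psi G + 2 * Nat.card (Subgroup.normalizer (Subgroup.zpowers t : Set G)) + 6 := by
  have := Fintype.ofFinite G
  have := sum_coset_bound t zpowers_le_centralizer (centralizer_le_normalizer ht) orderOf 7 9 6 8
    (fun x hx => seven_le_of_mem_zpowers ht hx) (fun x hx => nine_le_of_mem_centralizer ht hx)
    (fun x _ hx => six_le_of_notMem_zpowers fun h => hx (zpowers_le_centralizer h))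
    (fun x hx => eight_le_of_notMem_normalizer ht hx)
  rw [Nat.card_zpowers, ht, ← psi_eq_sum] at this
  simp only [Nat.cast_ofNat] at this
  lia

theorem card_normalizer_zpowers [Finite G] (ht : orderOf t = 3) :
    Nat.card (Subgroup.normalizer (Subgroup.zpowers t : Set G)) =
        Nat.card (Subgroup.centralizer {t}) ∨
      Nat.card (Subgroup.normalizer (Subgroup.zpowers t : Set G)) =
        2 * Nat.card (Subgroup.centralizer {t}) := by
  by_cases h : Subgroup.normalizer (Subgroup.zpowers t : Set G) ≤ Subgroup.centralizer {t}
  · exact .inl (by rw [le_antisymm h (centralizer_le_normalizer ht)])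
  right
  obtain ⟨a, ha, ha'⟩ := SetLike.not_le_iff_exists.1 h
  have key : ∀ b ∈ Subgroup.normalizer (Subgroup.zpowers t : Set G),
      b ∉ Subgroup.centralizer {t} → b * t * b⁻¹ = t⁻¹ := fun b hb hb' =>
    ((mem_normalizer_zpowers_iff ht).1 hb).resolve_left fun h => hb' (mem_centralizer_iff_conj.2 h)
  have h2 : (Subgroup.centralizer {t}).relIndex (Subgroup.normalizer (Subgroup.zpowers t : Set G))
      = 2 := by
    refine Subgroup.relIndex_eq_two_iff.2 ⟨a, ha, fun b hb => ?_⟩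
    by_cases hbc : b ∈ Subgroup.centralizer {t}
    · exact .inr ⟨hbc, by rwa [Subgroup.mul_mem_cancel_left _ hbc]⟩
    · refine .inl ⟨?_, hbc⟩
      rw [mem_centralizer_iff_conj, mul_inv_rev, ← mul_assoc, mul_assoc b, mul_assoc b,
        key a ha ha', ← conj_inv, key b hb hbc, inv_inv]
  have h3 := Subgroup.relIndex_mul_relIndex ⊥ _ _ bot_le (centralizer_le_normalizer ht)
  rw [h2, Subgroup.relIndex_bot_left, Subgroup.relIndex_bot_left] at h3
  lia

end OrderThree

theorem zpowers_normal_of_conj_mem {G : Type*} [Group G] {z : G}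
    (h : ∀ x : G, x * z * x⁻¹ ∈ Subgroup.zpowers z) : (Subgroup.zpowers z).Normal := by
  refine ⟨fun n hn x => ?_⟩
  obtain ⟨m, rfl⟩ := Subgroup.mem_zpowers_iff.1 hn
  rw [← conj_zpow]
  exact zpow_mem (h x) m

theorem exists_orderOf_eq_three_not_dvd_index {G : Type*} [Group G] [Finite G]
    (h : 3 ∣ Nat.card G) :
    ∃ t : G, orderOf t = 3 ∧ ¬ 3 ∣ (Subgroup.centralizer {t}).index := by
  have : Fact (Nat.Prime 3) := ⟨Nat.prime_three⟩
  let P : Sylow 3 G := default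
  have hP : Nontrivial P := (Subgroup.nontrivial_iff_ne_bot _).2 (P.ne_bot_of_dvd_card h)
  have hc : Nontrivial (Subgroup.center P) := P.isPGroup'.center_nontrivial
  have h3 : 3 ∣ Nat.card (Subgroup.center P) := by
    obtain ⟨n, hn, hn'⟩ := (P.isPGroup'.to_subgroup (Subgroup.center P)).nontrivial_iff_card.1 hc
    exact hn' ▸ dvd_pow_self 3 hn.ne'
  obtain ⟨z, hz⟩ := exists_prime_orderOf_dvd_card' 3 h3
  refine ⟨((z : P) : G), (Subgroup.orderOf_coe _).trans ((Subgroup.orderOf_coe _).trans hz),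
    fun hd => P.not_dvd_index (hd.trans ?_)⟩
  refine Subgroup.index_dvd_of_le fun x hx => Subgroup.mem_centralizer_singleton_iff.2 ?_
  exact congrArg Subtype.val (Subgroup.mem_center_iff.1 z.2 ⟨x, hx⟩)

section OrderThree

variable {G : Type*} [Group G] {t : G}

theorem three_dvd_card_centralizer (ht : orderOf t = 3) :
    3 ∣ Nat.card (Subgroup.centralizer {t}) := by
  rw [← ht, ← Nat.card_zpowers]
  exact Subgroup.card_dvd_of_le zpowers_le_centralizer

theorem exists_sylow_of_card_centralizer [Finite G] (ht : orderOf t = 3)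
    (hd : ¬ 3 ∣ (Subgroup.centralizer {t}).index)
    (hC : Nat.card (Subgroup.centralizer {t}) = 3) :
    ∃ P : Sylow 3 G, (P : Subgroup G) = Subgroup.zpowers t := by
  have : Fact (Nat.Prime 3) := ⟨Nat.prime_three⟩
  have hN := Subgroup.card_mul_index (Subgroup.centralizer {t})
  refine ⟨Sylow.ofCard (Subgroup.zpowers t) ?_, rfl⟩
  rw [Nat.card_zpowers, ht, ← hN, hC, Nat.factorization_mul (by simp) (by rintro h; simp [h] at hd)]
  simp [Nat.prime_three.factorization_self, Nat.factorization_eq_zero_of_not_dvd hd]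

theorem card_orderOf_eq_three_le [Fintype G] (ht : orderOf t = 3)
    (ht' : ∃ y, y * t * y⁻¹ = t⁻¹) (P : Sylow 3 G) (hP : (P : Subgroup G) = Subgroup.zpowers t) :
    (Finset.univ.filter fun x : G => orderOf x = 3).card ≤
      (Subgroup.centralizer {t}).index := by
  have : Fact (Nat.Prime 3) := ⟨Nat.prime_three⟩
  classical
  have : Fintype (G ⧸ Subgroup.centralizer {t}) := Fintype.ofFinite _
  have hsub : (Finset.univ.filter fun x : G => orderOf x = 3) ⊆
      Finset.univ.image fun q : G ⧸ Subgroup.centralizer {t} => q.out * t * q.out⁻¹ := by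
    intro u hu
    have hu : orderOf u = 3 := by simpa using hu
    have hup : IsPGroup 3 (Subgroup.zpowers u) :=
      IsPGroup.of_card (n := 1) (by rw [Nat.card_zpowers, hu, pow_one])
    obtain ⟨Q, hQ⟩ := hup.exists_le_sylow
    obtain ⟨g, rfl⟩ := MulAction.exists_smul_eq G P Q
    have := hQ (Subgroup.mem_zpowers u)
    rw [Sylow.coe_subgroup_smul, hP, Subgroup.mem_pointwise_smul_iff_inv_smul_mem,
      mem_zpowers_iff_of_orderOf_eq_three ht, MulAut.smul_def, MulAut.inv_def,
      MulAut.conj_symm_apply] at this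
    obtain ⟨x, hx⟩ : ∃ x, x * t * x⁻¹ = u := by
      obtain ⟨y, hy⟩ := ht'
      rcases this with h | h | h
      · rw [mul_assoc, inv_mul_eq_one, eq_comm, mul_eq_right] at h
        simp [h] at hu
      · exact ⟨g, by rw [← h]; group⟩
      · refine ⟨g * y, ?_⟩
        calc g * y * t * (g * y)⁻¹ = g * (y * t * y⁻¹) * g⁻¹ := by group
          _ = u := by rw [hy, ← h]; group
    obtain ⟨c, hc⟩ := QuotientGroup.mk_out_eq_mul (Subgroup.centralizer {t}) x
    refine Finset.mem_image.2 ⟨x, Finset.mem_univ _, ?_⟩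
    calc (x : G ⧸ Subgroup.centralizer {t}).out * t * (x : G ⧸ Subgroup.centralizer {t}).out⁻¹
        = x * (c * t * (c : G)⁻¹) * x⁻¹ := by rw [hc]; group
      _ = u := by rw [mem_centralizer_iff_conj.1 c.2, hx]
  refine (Finset.card_le_card hsub).trans (Finset.card_image_le.trans ?_)
  rw [Finset.card_univ, ← Nat.card_eq_fintype_card, Subgroup.index]

theorem index_normalizer_cases {C D N k s : ℕ} (hC : 0 < C) (h3 : 3 ∣ C) (hk : ¬ 3 ∣ k)
    (hD : D = C ∨ D = 2 * C) (hN : D * k = N) (hb : 8 * N + 3 * C ≤ 3 * s + 2 * D + 6)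
    (hs : 12 * s < 31 * N) :
    k = 1 ∨ N = 6 ∨ (k = 2 ∧ D = 2 * C) ∨ (C = 3 ∧ D = 6 ∧ k = 4) ∨ (C = 3 ∧ k = 5) := by
  obtain ⟨c, rfl⟩ := h3
  subst hN
  rcases hD with rfl | rfl
  · have h : k < 8 := by nlinarith [Nat.le_mul_of_pos_left k (show 0 < c by lia)]
    interval_cases k <;> lia
  · have h : k < 8 := by
      by_contra! h8
      nlinarith [Nat.mul_le_mul_left c h8, show 1 ≤ c by lia]
    interval_cases k <;> lia

theorem index_normalizer_ne_five [Finite G] (ht : orderOf t = 3)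
    (hd : ¬ 3 ∣ (Subgroup.centralizer {t}).index)
    (hC : Nat.card (Subgroup.centralizer {t}) = 3) :
    (Subgroup.normalizer (Subgroup.zpowers t : Set G)).index ≠ 5 := by
  have : Fact (Nat.Prime 3) := ⟨Nat.prime_three⟩
  obtain ⟨P, hP⟩ := exists_sylow_of_card_centralizer ht hd hC
  have h1 := card_sylow_modEq_one 3 G
  intro h5
  rw [P.card_eq_index_normalizer, ← P.coe_coe, hP, h5] at h1
  exact absurd h1 (by decide)

theorem exists_conj_eq_inv (ht : orderOf t = 3)
    (hD : Nat.card (Subgroup.normalizer (Subgroup.zpowers t : Set G)) ≠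
      Nat.card (Subgroup.centralizer {t})) : ∃ y, y * t * y⁻¹ = t⁻¹ := by
  by_contra! h
  refine hD ?_
  rw [le_antisymm (fun g hg => ?_) (centralizer_le_normalizer ht)]
  exact mem_centralizer_iff_conj.2 (((mem_normalizer_zpowers_iff ht).1 hg).resolve_right (h g))

theorem le_psi_of_card_eq_twenty_four [Finite G] (ht : orderOf t = 3)
    (hd : ¬ 3 ∣ (Subgroup.centralizer {t}).index)
    (hC : Nat.card (Subgroup.centralizer {t}) = 3)
    (hD : Nat.card (Subgroup.normalizer (Subgroup.zpowers t : Set G)) = 6)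
    (hG : Nat.card G = 24) : 67 ≤ psi G := by
  classical
  have := Fintype.ofFinite G
  obtain ⟨P, hP⟩ := exists_sylow_of_card_centralizer ht hd hC
  have hS := card_orderOf_eq_three_le ht (exists_conj_eq_inv ht (by lia)) P hP
  have hi := Subgroup.card_mul_index (Subgroup.centralizer {t})
  have hsum := sum_coset_bound t zpowers_le_centralizer (centralizer_le_normalizer ht)
    (fun x => orderOf x + if orderOf x = 3 then 1 else 0) 9 9 6 10 ?_ ?_ ?_ ?_
  · rw [Finset.sum_add_distrib, ← psi_eq_sum, Finset.sum_boole, Nat.card_zpowers, ht, hC, hD,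
      hG] at hsum
    rw [hC, hG] at hi
    simp only [Nat.cast_ofNat, Nat.cast_id] at hsum
    lia
  · intro x hx
    have h3 : t * t = t⁻¹ := by rw [← sq, sq_eq_inv_of_orderOf_eq_three ht]
    have h4 : t⁻¹ * t⁻¹ = t := by rw [← mul_inv_rev, h3, inv_inv]
    rw [sq_eq_inv_of_orderOf_eq_three ht]
    rcases (mem_zpowers_iff_of_orderOf_eq_three ht).1 hx with rfl | rfl | rfl <;>
      simp [h3, h4, ht]
  · intro x hx hx'
    have := nine_le_of_mem_centralizer ht hx hx'
    lia
  · intro x _ hx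
    have := six_le_of_notMem_zpowers fun h => hx (zpowers_le_centralizer h)
    lia
  · intro x hx
    obtain ⟨h0, h1, h2⟩ := mul_ne_one_of_notMem_zpowers (notMem_zpowers_of_notMem_normalizer hx)
    have := two_le_orderOf h0
    have := two_le_orderOf h1
    have := two_le_orderOf h2
    rcases sq_ne_one_of_notMem_normalizer ht hx with ⟨h, h'⟩ | ⟨h, h'⟩ | ⟨h, h'⟩ <;>
    · have := three_le_orderOf h
      have := three_le_orderOf h'
      split_ifs <;> lia

theorem sq_mem_centralizer (ht : orderOf t = 3) {d : G}
    (hd : d ∈ Subgroup.normalizer (Subgroup.zpowers t : Set G)) :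
    d ^ 2 ∈ Subgroup.centralizer {t} := by
  rw [mem_centralizer_iff_conj]
  have e : d ^ 2 * t * (d ^ 2)⁻¹ = d * (d * t * d⁻¹) * d⁻¹ := by simp [sq, mul_assoc]
  rw [e]
  rcases (mem_normalizer_zpowers_iff ht).1 hd with h | h
  · rw [h, h]
  · rw [h, ← conj_inv, h, inv_inv]

theorem exists_sq_eq_one_notMem_normalizer [Finite G] (ht : orderOf t = 3)
    (h2 : (Subgroup.normalizer (Subgroup.zpowers t : Set G)).index = 2)
    (hD : Nat.card (Subgroup.normalizer (Subgroup.zpowers t : Set G)) =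
      2 * Nat.card (Subgroup.centralizer {t}))
    (hs : 12 * psi G < 31 * Nat.card G) :
    ∃ g ∉ Subgroup.normalizer (Subgroup.zpowers t : Set G), g ^ 2 = 1 := by
  by_contra! h
  have := Fintype.ofFinite G
  have htm : t ∈ Subgroup.normalizer (Subgroup.zpowers t : Set G) :=
    Subgroup.le_normalizer (Subgroup.mem_zpowers t)
  have hsum := sum_coset_bound t zpowers_le_centralizer (centralizer_le_normalizer ht) orderOf
    7 9 6 9 (fun x hx => seven_le_of_mem_zpowers ht hx)
    (fun x hx => nine_le_of_mem_centralizer ht hx)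
    (fun x _ hx => six_le_of_notMem_zpowers fun h => hx (zpowers_le_centralizer h))
    (fun x hx => by
      have := three_le_orderOf (h x hx)
      have := three_le_orderOf (h (x * t) (by rwa [Subgroup.mul_mem_cancel_right _ htm]))
      have := three_le_orderOf
        (h (x * t ^ 2) (by rwa [Subgroup.mul_mem_cancel_right _ (pow_mem htm 2)]))
      lia)
  have hN := Subgroup.card_mul_index (Subgroup.normalizer (Subgroup.zpowers t : Set G))
  have h3 := Nat.le_of_dvd Nat.card_pos (three_dvd_card_centralizer ht)
  rw [Nat.card_zpowers, ht, ← psi_eq_sum] at hsum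
  simp only [Nat.cast_ofNat] at hsum
  lia

theorem sq_eq_one_of_mem_normalizer [Finite G] (ht : orderOf t = 3)
    (h2 : (Subgroup.normalizer (Subgroup.zpowers t : Set G)).index = 2)
    (hD : Nat.card (Subgroup.normalizer (Subgroup.zpowers t : Set G)) =
      2 * Nat.card (Subgroup.centralizer {t}))
    (hs : 12 * psi G < 31 * Nat.card G) {y : G}
    (hy : y ∈ Subgroup.normalizer (Subgroup.zpowers t : Set G))
    (hy' : y ∉ Subgroup.centralizer {t}) : y ^ 2 = 1 := by
  classical
  by_contra h
  have := Fintype.ofFinite G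
  have h4 : 4 ≤ orderOf y := by
    refine four_le_orderOf h fun h3 => hy' ?_
    have : y = (y ^ 2)⁻¹ := eq_inv_of_mul_eq_one_right (by rw [← h3, ← pow_succ])
    rw [this]
    exact inv_mem (sq_mem_centralizer ht hy)
  have htC : t ∈ Subgroup.centralizer {t} := zpowers_le_centralizer (Subgroup.mem_zpowers t)
  have htD := centralizer_le_normalizer ht htC
  let f : G → ℕ := fun x => if x = y then 2 else orderOf x
  have hfC : ∀ x ∈ Subgroup.centralizer {t}, f x = orderOf x := fun x hx =>
    if_neg (ne_of_mem_of_not_mem hx hy')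
  have hfD : ∀ x ∉ Subgroup.normalizer (Subgroup.zpowers t : Set G), f x = orderOf x :=
    fun x hx => if_neg (ne_of_mem_of_not_mem hy hx).symm
  have hf2 : ∀ x, x ≠ 1 → 2 ≤ f x := by
    intro x hx
    have := two_le_orderOf hx
    simp only [f]
    split_ifs <;> lia
  have hf : ∑ x, f x + 2 ≤ psi G := by
    have : ∑ x, (f x + if x = y then 2 else 0) ≤ ∑ x : G, orderOf x := by
      refine Finset.sum_le_sum fun x _ => ?_
      by_cases hxy : x = y
      · simp only [f, hxy, if_true]
        exact h4
      · simp [f, hxy]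
    rw [Finset.sum_add_distrib, Finset.sum_ite_eq' Finset.univ y] at this
    rw [psi_eq_sum]
    simpa using this
  have hsum := sum_coset_bound t zpowers_le_centralizer (centralizer_le_normalizer ht) f 7 9 6 8
    (fun x hx => by
      have hxC := zpowers_le_centralizer hx
      rw [hfC _ hxC, hfC _ (mul_mem hxC htC), hfC _ (mul_mem hxC (pow_mem htC 2))]
      exact seven_le_of_mem_zpowers ht hx)
    (fun x hxC hx => by
      rw [hfC _ hxC, hfC _ (mul_mem hxC htC), hfC _ (mul_mem hxC (pow_mem htC 2))]
      exact nine_le_of_mem_centralizer ht hxC hx)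
    (fun x _ hx => by
      obtain ⟨h0, h1, h2⟩ :=
        mul_ne_one_of_notMem_zpowers fun h => hx (zpowers_le_centralizer h)
      have := hf2 _ h0
      have := hf2 _ h1
      have := hf2 _ h2
      lia)
    (fun x hx => by
      rw [hfD _ hx, hfD _ (by rwa [Subgroup.mul_mem_cancel_right _ htD]),
        hfD _ (by rwa [Subgroup.mul_mem_cancel_right _ (pow_mem htD 2)])]
      exact eight_le_of_notMem_normalizer ht hx)
  have hN := Subgroup.card_mul_index (Subgroup.normalizer (Subgroup.zpowers t : Set G))
  rw [Nat.card_zpowers, ht] at hsum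
  simp only [Nat.cast_ofNat] at hsum
  lia

theorem exists_zpowers_normal_of_index_eq_two [Finite G] (ht : orderOf t = 3)
    (h2 : (Subgroup.normalizer (Subgroup.zpowers t : Set G)).index = 2)
    (hD : Nat.card (Subgroup.normalizer (Subgroup.zpowers t : Set G)) =
      2 * Nat.card (Subgroup.centralizer {t}))
    (hs : 12 * psi G < 31 * Nat.card G) :
    ∃ z : G, z ≠ 1 ∧ (Subgroup.zpowers z).Normal := by
  obtain ⟨g, hg, hg2⟩ := exists_sq_eq_one_notMem_normalizer ht h2 hD hs
  obtain ⟨y, hy⟩ := exists_conj_eq_inv ht (by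
    have := Nat.card_pos (α := Subgroup.centralizer {t})
    lia)
  have hsq := fun {y} => sq_eq_one_of_mem_normalizer (y := y) ht h2 hD hs
  have hCD := centralizer_le_normalizer ht
  have hn := Subgroup.normal_of_index_eq_two h2
  have hyD := (mem_normalizer_zpowers_iff ht).2 (.inr hy)
  have hyC : y ∉ Subgroup.centralizer {t} := fun h => ne_inv_of_orderOf_eq_three ht
    ((mem_centralizer_iff_conj.1 h).symm.trans hy)
  have hg1 : g⁻¹ = g := by rw [inv_eq_iff_mul_eq_one, ← sq, hg2]
  obtain ⟨s, hs⟩ : ∃ s, s = g * t * g⁻¹ := ⟨_, rfl⟩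
  have hs3 : s ^ 3 = 1 := by
    rw [hs, conj_pow, ← ht, pow_orderOf_eq_one, mul_one, mul_inv_cancel]
  have hsC : s ∈ Subgroup.centralizer {t} := by
    have hsD : s ∈ Subgroup.normalizer (Subgroup.zpowers t : Set G) :=
      hs ▸ hn.conj_mem t (Subgroup.le_normalizer (Subgroup.mem_zpowers t)) g
    have : s = (s ^ 2) ^ 2 := by
      rw [← pow_mul, show 2 * 2 = 3 + 1 from rfl, pow_succ, hs3, one_mul]
    rw [this]
    exact pow_mem (sq_mem_centralizer ht hsD) 2
  have hcomm : s * t = t * s := Subgroup.mem_centralizer_singleton_iff.1 hsC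
  have hinv : ∀ x ∈ Subgroup.normalizer (Subgroup.zpowers t : Set G),
      x ∉ Subgroup.centralizer {t} → x * s * x⁻¹ = s⁻¹ := fun x hx hx' =>
    conj_eq_inv_of_sq_eq_one (hsq hx hx') (hsq (mul_mem hx (hCD hsC))
      (by rwa [Subgroup.mul_mem_cancel_right _ hsC]))
  have hfix : ∀ x ∈ Subgroup.centralizer {t}, x * s * x⁻¹ = s := by
    intro x hx
    have h1 := hinv (x * y) (mul_mem (hCD hx) hyD) (by rwa [Subgroup.mul_mem_cancel_left _ hx])
    have e : x * y * s * (x * y)⁻¹ = x * (y * s * y⁻¹) * x⁻¹ := by group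
    rw [e, hinv y hyD hyC, ← conj_inv, inv_inj] at h1
    exact h1
  have hz : ∀ x ∈ Subgroup.normalizer (Subgroup.zpowers t : Set G),
      x * (s * t) * x⁻¹ = s * t ∨ x * (s * t) * x⁻¹ = (s * t)⁻¹ := by
    intro x hx
    have e : x * (s * t) * x⁻¹ = (x * s * x⁻¹) * (x * t * x⁻¹) := by group
    rw [e]
    by_cases hxC : x ∈ Subgroup.centralizer {t}
    · rw [hfix x hxC, mem_centralizer_iff_conj.1 hxC]
      exact .inl rfl
    · rw [hinv x hx hxC, ((mem_normalizer_zpowers_iff ht).1 hx).resolve_left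
        fun h => hxC (mem_centralizer_iff_conj.2 h), ← mul_inv_rev, hcomm]
      exact .inr rfl
  have hgz : g * (s * t) * g⁻¹ = s * t := by
    have h1 : g * s * g⁻¹ = t := by
      calc g * s * g⁻¹ = (g * g) * t * (g * g)⁻¹ := by rw [hs]; group
        _ = t := by rw [← sq, hg2]; group
    calc g * (s * t) * g⁻¹ = (g * s * g⁻¹) * (g * t * g⁻¹) := by group
      _ = s * t := by rw [h1, ← hs, hcomm]
  refine ⟨s * t, fun h => hg ?_, zpowers_normal_of_conj_mem fun x => ?_⟩
  · exact (mem_normalizer_zpowers_iff ht).2 (.inr (hs ▸ mul_eq_one_iff_eq_inv.1 h))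
  · by_cases hx : x ∈ Subgroup.normalizer (Subgroup.zpowers t : Set G)
    · rcases hz x hx with h | h <;> rw [h]
      · exact Subgroup.mem_zpowers _
      · exact inv_mem (Subgroup.mem_zpowers _)
    · have hgx : g * x ∈ Subgroup.normalizer (Subgroup.zpowers t : Set G) := by
        rw [Subgroup.mul_mem_iff_of_index_two h2]
        tauto
      have e : x * (s * t) * x⁻¹ = g * (g * x * (s * t) * (g * x)⁻¹) * g⁻¹ := by
        calc x * (s * t) * x⁻¹ = (g⁻¹ * g) * x * (s * t) * ((g⁻¹ * g) * x)⁻¹ := by group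
          _ = _ := by nth_rw 1 3 [hg1]; group
      rw [e]
      rcases hz _ hgx with h | h <;> rw [h]
      · rw [hgz]
        exact Subgroup.mem_zpowers _
      · rw [← conj_inv, hgz]
        exact inv_mem (Subgroup.mem_zpowers _)

theorem exists_zpowers_normal_of_three_dvd [Finite G] (h3 : 3 ∣ Nat.card G)
    (hs : 12 * psi G < 31 * Nat.card G) :
    ∃ z : G, z ≠ 1 ∧ (Subgroup.zpowers z).Normal := by
  obtain ⟨t, ht, hd⟩ := exists_orderOf_eq_three_not_dvd_index h3
  have hN := Subgroup.card_mul_index (Subgroup.normalizer (Subgroup.zpowers t : Set G))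
  have hk : ¬ 3 ∣ (Subgroup.normalizer (Subgroup.zpowers t : Set G)).index := fun h =>
    hd (h.trans (Subgroup.index_dvd_of_le (centralizer_le_normalizer ht)))
  rcases index_normalizer_cases Nat.card_pos (three_dvd_card_centralizer ht) hk
    (card_normalizer_zpowers ht) hN (psi_coset_bound ht) hs with h | h | h | h | h
  · refine ⟨t, ne_one_of_orderOf_eq_three ht, ?_⟩
    rwa [Subgroup.index_eq_one, Subgroup.normalizer_eq_top_iff] at h
  · refine ⟨t, ne_one_of_orderOf_eq_three ht, Subgroup.normal_of_index_eq_two ?_⟩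
    have := Subgroup.card_mul_index (Subgroup.zpowers t)
    rw [Nat.card_zpowers, ht, h] at this
    lia
  · exact exists_zpowers_normal_of_index_eq_two ht h.1 h.2 hs
  · rw [h.2.1, h.2.2] at hN
    have := le_psi_of_card_eq_twenty_four ht hd h.1 h.2.1 hN.symm
    lia
  · exact absurd h.2 (index_normalizer_ne_five ht hd h.1)

end OrderThree

theorem card_sq_eq_one_bound {G : Type*} [Group G] [Fintype G] [DecidableEq G]
    (h3 : ¬ 3 ∣ Nat.card G) :
    4 * Nat.card G ≤ psi G + 2 * (Finset.univ.filter fun x : G => x ^ 2 = 1).card + 1 := by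
  have : ∑ _x : G, 4 ≤ ∑ x : G,
      (orderOf x + 2 * (if x ^ 2 = 1 then 1 else 0) + if x = 1 then 1 else 0) := by
    refine Finset.sum_le_sum fun x _ => ?_
    by_cases h1 : x = 1
    · simp [h1]
    have := two_le_orderOf h1
    by_cases h2 : x ^ 2 = 1
    · simp only [h1, h2, if_true, if_false]
      lia
    have : 4 ≤ orderOf x := four_le_orderOf h2 fun h => h3 <| by
      rw [← orderOf_eq_prime h h1]
      exact orderOf_dvd_natCard x
    lia
  rw [Finset.sum_add_distrib, Finset.sum_add_distrib, ← psi_eq_sum, ← Finset.mul_sum,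
    Finset.sum_boole, Finset.sum_ite_eq' Finset.univ (1 : G), Finset.sum_const, Finset.card_univ,
    ← Nat.card_eq_fintype_card] at this
  simp only [smul_eq_mul, Nat.cast_id, Finset.mem_univ, if_true] at this
  lia

theorem two_mul_card_sq_eq_one_le {G : Type*} [Group G] [Fintype G] [DecidableEq G] {x : G}
    (hx : x ^ 2 = 1) :
    2 * (Finset.univ.filter fun x : G => x ^ 2 = 1).card ≤
      Nat.card (Subgroup.centralizer {x}) + Nat.card G := by
  classical
  set S := Finset.univ.filter fun x : G => x ^ 2 = 1 with hS
  let T := S.map (Equiv.mulLeft x⁻¹).toEmbedding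
  have h1 : (S ∩ T).card ≤ Nat.card (Subgroup.centralizer {x}) := by
    have h : (S ∩ T).card ≤
        (Finset.univ.filter fun y : G => y ∈ Subgroup.centralizer {x}).card := by
      refine Finset.card_le_card fun y hy => ?_
      obtain ⟨hy, hyT⟩ := Finset.mem_inter.1 hy
      obtain ⟨z, hz, rfl⟩ := Finset.mem_map.1 hyT
      have hz2 : z ^ 2 = 1 := by simpa [hS] using hz
      have hy2 : (x⁻¹ * z) ^ 2 = 1 := by simpa [hS] using hy
      have hinv : x⁻¹ = x := by rw [inv_eq_iff_mul_eq_one, ← sq, hx]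
      have hzi : z⁻¹ = z := by rw [inv_eq_iff_mul_eq_one, ← sq, hz2]
      have h3 := conj_eq_inv_of_sq_eq_one (by rw [hinv, hx]) hy2
      rw [inv_inv, hinv, hzi] at h3
      simp only [Finset.mem_filter, Finset.mem_univ, true_and, Equiv.coe_toEmbedding,
        Equiv.coe_mulLeft, Subgroup.mem_centralizer_singleton_iff, hinv]
      rw [h3, ← mul_assoc, ← sq, hx, one_mul]
    exact h.trans (Nat.subtype_card
      (Finset.univ.filter fun y : G => y ∈ Subgroup.centralizer {x}) (by simp)).ge
  have h2 : (S ∪ T).card ≤ Nat.card G := by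
    rw [Nat.card_eq_fintype_card]
    exact Finset.card_le_univ _
  have h3 := Finset.card_union_add_card_inter S T
  have h4 : T.card = S.card := Finset.card_map _
  lia

theorem commutator_mem_of_index_le_two {G : Type*} [Group G] {K : Subgroup G}
    (hK : K.index = 1 ∨ K.index = 2) (g h : G) :
    g * h * g⁻¹ * h⁻¹ ∈ K := by
  rcases hK with hK | hK
  · rw [Subgroup.index_eq_one.1 hK]
    trivial
  · rw [Subgroup.mul_mem_iff_of_index_two hK,
      Subgroup.mul_mem_iff_of_index_two hK, Subgroup.mul_mem_iff_of_index_two hK, inv_mem_iff,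
      inv_mem_iff]
    tauto

theorem zpowers_normal_of_forall_commute {G : Type*} [Group G] {z : G}
    (h : ∀ x : G, x * z = z * x) : (Subgroup.zpowers z).Normal :=
  zpowers_normal_of_conj_mem fun x => by
    rw [h, mul_inv_cancel_right]
    exact Subgroup.mem_zpowers z

theorem exists_zpowers_normal_of_not_three_dvd {G : Type*} [Group G] [Finite G] [Nontrivial G]
    (h3 : ¬ 3 ∣ Nat.card G) (hs : 12 * psi G < 31 * Nat.card G) :
    ∃ z : G, z ≠ 1 ∧ (Subgroup.zpowers z).Normal := by
  classical
  have := Fintype.ofFinite G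
  have hb := card_sq_eq_one_bound h3
  have hindex : ∀ x : G, x ^ 2 = 1 → (Subgroup.centralizer {x}).index = 1 ∨
      (Subgroup.centralizer {x}).index = 2 := by
    intro x hx
    have h1 := two_mul_card_sq_eq_one_le hx
    have hN := Subgroup.card_mul_index (Subgroup.centralizer {x})
    have h0 : (Subgroup.centralizer {x}).index ≠ 0 := Subgroup.index_ne_zero_of_finite
    have hne : (Subgroup.centralizer {x}).index ≠ 3 := fun h => h3 ⟨_, by rw [← hN, h, mul_comm]⟩
    by_contra! hcon
    have h4 : 4 ≤ (Subgroup.centralizer {x}).index := by lia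
    have h5 : 2 ≤ Nat.card (Subgroup.centralizer {x}) := by
      by_contra! hlt
      have h6 : Nat.card (Subgroup.centralizer {x}) = 1 := by
        have := Nat.card_pos (α := Subgroup.centralizer {x})
        lia
      have hx1 : x = 1 := by
        have := Subgroup.card_eq_one.1 h6
        exact (Subgroup.mem_bot).1 (this ▸ Subgroup.mem_centralizer_singleton_iff.2 rfl)
      exact hcon.1 (by simp [hx1])
    have h6 := Nat.mul_le_mul_left (Nat.card (Subgroup.centralizer {x})) h4
    lia
  by_cases hcomm : ∀ g h : G, g * h = h * g
  · obtain ⟨z, hz⟩ := exists_ne (1 : G)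
    exact ⟨z, hz, zpowers_normal_of_forall_commute fun x => hcomm x z⟩
  push Not at hcomm
  obtain ⟨g, h, hgh⟩ := hcomm
  obtain ⟨c, hc⟩ : ∃ c, c = g * h * g⁻¹ * h⁻¹ := ⟨_, rfl⟩
  have hc1 : c ≠ 1 := by
    rwa [hc, Ne, mul_inv_eq_one, mul_inv_eq_iff_eq_mul]
  refine ⟨c, hc1, zpowers_normal_of_forall_commute fun x => ?_⟩
  have hcard : (Finset.univ.filter fun x : G => x ^ 2 = 1).card ≤
      Nat.card (Subgroup.centralizer {c}) := by
    rw [Nat.subtype_card (Finset.univ.filter fun y : G => y ∈ Subgroup.centralizer {c})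
      (by simp)]
    refine Finset.card_le_card fun y hy => ?_
    have hy : y ^ 2 = 1 := by simpa using hy
    have := Subgroup.mem_centralizer_singleton_iff.1
      (hc ▸ commutator_mem_of_index_le_two (hindex y hy) g h)
    simpa [Subgroup.mem_centralizer_singleton_iff] using this.symm
  have hN := Subgroup.card_mul_index (Subgroup.centralizer {c})
  have h2 : 1 < Nat.card (Subgroup.centralizer {c}) := by
    rw [Subgroup.one_lt_card_iff_ne_bot]
    intro hbot
    exact hc1 ((Subgroup.mem_bot).1 (hbot ▸ Subgroup.mem_centralizer_singleton_iff.2 rfl))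
  have hi : (Subgroup.centralizer {c}).index = 1 := by
    have h0 : (Subgroup.centralizer {c}).index ≠ 0 := Subgroup.index_ne_zero_of_finite
    by_contra hne
    have h6 := Nat.mul_le_mul_left (Nat.card (Subgroup.centralizer {c}))
      (show 2 ≤ (Subgroup.centralizer {c}).index by lia)
    lia
  exact Subgroup.mem_centralizer_singleton_iff.1 (Subgroup.index_eq_one.1 hi ▸ Subgroup.mem_top x)

/-- If a finite group `G` satisfies `o(G) < 31/12`, then `G` is supersolvable. -/
theorem stmt_0 (G : Type*) [Group G] [Finite G] (h : avgOrder G < 31 / 12) :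
    IsSupersolvable G := by
  refine isSupersolvable_of_exists_zpowers_normal ?_ G ((avgOrder_lt_iff G).1 h)
  intro G _ _ _ hs
  by_cases h3 : 3 ∣ Nat.card G
  · exact exists_zpowers_normal_of_three_dvd h3 hs
  · exact exists_zpowers_normal_of_not_three_dvd h3 hs
end

section
/- Let G be a finite group, let 1 = d_1 < d_2 < … < d_r be the (distinct) orders of elements of G, and let n_{d_i}(G) be the number of elements of order d_i in G for each i. Assume r ≥ 3 and let s be an integer with 3 ≤ s ≤ r. If o(G) < c for a positive real number c, then n_{d_{s−1}}(G) > ((d_s − c)/(d_s − d_{s−1}))·|G| − Σ_{i=1}^{s−2} ((d_s − d_i)/(d_s − d_{s−1}))·n_{d_i}(G). -/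
theorem sum_ite_orderOf_eq (G : Type*) [Group G] [Fintype G] (k : ℕ) (a : ℝ) :
    ∑ x : G, (if orderOf x = k then a else 0) = a * (nOrd G k : ℝ) := by
  classical
  rw [← Finset.sum_filter, Finset.sum_const, nsmul_eq_mul, mul_comm, nOrd,
    Nat.card_eq_fintype_card, Fintype.card_subtype]

theorem psi_lt_of_avgOrder_lt (G : Type*) [Group G] [Finite G] {c : ℝ}
    (h : (avgOrder G : ℝ) < c) : (psi G : ℝ) < c * Nat.card G := by
  have hG : (0 : ℝ) < Nat.card G := by exact_mod_cast Nat.card_pos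
  rw [avgOrder] at h
  push_cast at h
  exact (div_lt_iff₀ hG).mp h

/-- Lemma 2.1: if `1 = d 0 < d 1 < … < d (r-1)` are the element orders of a finite
group `G`, `r ≥ 3`, `3 ≤ s ≤ r` and `o(G) < c` for a positive real `c`, then
`n_{d_{s-1}}(G) > ((d_s - c)/(d_s - d_{s-1}))|G| - ∑_{i=1}^{s-2} ((d_s - d_i)/(d_s - d_{s-1})) n_{d_i}(G)`
(here stated with `0`-based indexing: the paper's `d_j` is `d (j-1)`). -/
theorem stmt_3 (G : Type*) [Group G] [Finite G] (r : ℕ) (hr : 3 ≤ r)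
    (d : Fin r → ℕ) (hmono : StrictMono d) (hd1 : d ⟨0, by omega⟩ = 1)
    (horders : ∀ x : G, ∃ i : Fin r, orderOf x = d i)
    (hall : ∀ i : Fin r, ∃ x : G, orderOf x = d i)
    (s : ℕ) (hs : 3 ≤ s) (hsr : s ≤ r)
    (c : ℝ) (hc : 0 < c) (h : (avgOrder G : ℝ) < c) :
    (nOrd G (d ⟨s - 2, by omega⟩) : ℝ) >
      (((d ⟨s - 1, by omega⟩ : ℝ) - c) /
          ((d ⟨s - 1, by omega⟩ : ℝ) - (d ⟨s - 2, by omega⟩ : ℝ))) * (Nat.card G : ℝ) -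
        ∑ i : Fin (s - 2),
          (((d ⟨s - 1, by omega⟩ : ℝ) - (d (Fin.castLE (by omega) i) : ℝ)) /
              ((d ⟨s - 1, by omega⟩ : ℝ) - (d ⟨s - 2, by omega⟩ : ℝ))) *
            (nOrd G (d (Fin.castLE (by omega) i)) : ℝ) := by
  have := Fintype.ofFinite G
  have hsr' : s - 2 ≤ r := by omega
  set D : ℝ := (d ⟨s - 1, by omega⟩ : ℝ) with hD
  set E : ℝ := (d ⟨s - 2, by omega⟩ : ℝ) with hE
  have hED : 0 < D - E := by
    rw [sub_pos, hD, hE, Nat.cast_lt]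
    exact hmono (Fin.mk_lt_mk.mpr (by omega))
  have hle (i : Fin (s - 2)) : 0 ≤ D - (d (Fin.castLE hsr' i) : ℝ) := by
    rw [sub_nonneg, hD, Nat.cast_le]
    have hi := i.isLt
    exact hmono.monotone (Fin.le_def.mpr (show (i : ℕ) ≤ s - 1 by omega))
  have hpoint (x : G) : D - (orderOf x : ℝ) ≤
      (if orderOf x = d ⟨s - 2, by omega⟩ then D - E else 0) +
        ∑ i : Fin (s - 2), if orderOf x = d (Fin.castLE hsr' i) then
          D - (d (Fin.castLE hsr' i) : ℝ) else 0 := by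
    have hlast : 0 ≤ if orderOf x = d ⟨s - 2, by omega⟩ then D - E else 0 := by
      split_ifs <;> linarith
    have hterm (i : Fin (s - 2)) : 0 ≤ if orderOf x = d (Fin.castLE hsr' i) then
        D - (d (Fin.castLE hsr' i) : ℝ) else 0 := by
      split_ifs
      exacts [hle i, le_rfl]
    have hsum := Finset.sum_nonneg fun i (_ : i ∈ Finset.univ) => hterm i
    obtain ⟨j, hj⟩ := horders x
    rcases lt_trichotomy (j : ℕ) (s - 2) with hlt | heq | hgt
    · have hsingle := Finset.single_le_sum (fun i _ => hterm i)
        (Finset.mem_univ (⟨j, hlt⟩ : Fin (s - 2)))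
      have hcast : Fin.castLE hsr' (⟨j, hlt⟩ : Fin (s - 2)) = j := rfl
      rw [hcast, if_pos hj, ← hj] at hsingle
      linarith
    · have hjs : j = ⟨s - 2, by omega⟩ := Fin.ext heq
      rw [hjs] at hj
      have hxE : (orderOf x : ℝ) = E := by rw [hj]
      rw [if_pos hj, hxE]
      linarith
    · have hDj : D ≤ (orderOf x : ℝ) := by
        rw [hD, hj, Nat.cast_le]
        exact hmono.monotone (Fin.le_def.mpr (show s - 1 ≤ (j : ℕ) by omega))
      linarith
  have htotal := Finset.sum_le_sum fun x (_ : x ∈ Finset.univ) => hpoint x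
  rw [Finset.sum_add_distrib, Finset.sum_comm, Finset.sum_sub_distrib] at htotal
  simp only [sum_ite_orderOf_eq, Finset.sum_const, Finset.card_univ, nsmul_eq_mul] at htotal
  rw [← Nat.cast_sum, ← psi_eq_sum, ← Nat.card_eq_fintype_card] at htotal
  have hpsi := psi_lt_of_avgOrder_lt G h
  simp only [div_mul_eq_mul_div, ← Finset.sum_div]
  rw [gt_iff_lt, ← sub_div, div_lt_iff₀ hED]
  linarith
end

section
/- Let G be a finite abelian group with o(G) < 31/12. Then either G is isomorphic to the cyclic group C_3, or G is an elementary abelian 2-group (i.e., every non-identity element of G has order 2). -/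
theorem three_le_orderOf_of_sq_ne_one {G : Type*} [Group G] [Finite G] {x : G}
    (hx : x ^ 2 ≠ 1) : 3 ≤ orderOf x := by
  have h0 := orderOf_pos x
  have hdvd : ¬ orderOf x ∣ 2 := fun h => hx (orderOf_dvd_iff_pow_eq_one.mp h)
  by_contra! hlt
  interval_cases orderOf x <;> simp at hdvd

theorem two_le_orderOf_of_ne_one {G : Type*} [Group G] [Finite G] {x : G}
    (hx : x ≠ 1) : 2 ≤ orderOf x := by
  have h0 := orderOf_pos x
  have h1 : orderOf x ≠ 1 := fun h => hx (orderOf_eq_one_iff.mp h)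
  omega

theorem eight_le_orderOf_add_orderOf_mul {G : Type*} [CommGroup G] [Finite G] {x y : G}
    (hy : orderOf y = 2) (hx : x ^ 2 ≠ 1) : 8 ≤ orderOf x + orderOf (y * x) := by
  have hy2 : y ^ 2 = 1 := orderOf_dvd_iff_pow_eq_one.mp hy.dvd
  have hsix : ∀ z : G, orderOf z = 3 → orderOf (y * z) = 6 := fun z hz => by
    rw [(Commute.all y z).orderOf_mul_eq_mul_orderOf_of_coprime (by rw [hy, hz]; decide), hy, hz]
  have h1 := three_le_orderOf_of_sq_ne_one hx
  have h2 : 3 ≤ orderOf (y * x) :=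
    three_le_orderOf_of_sq_ne_one (by rwa [mul_pow, hy2, one_mul])
  have h3 := hsix x
  have h4 := hsix (y * x)
  rw [← mul_assoc, ← sq, hy2, one_mul] at h4
  omega

theorem three_mul_card_le_psi_add_one {G : Type*} [CommGroup G] [Finite G] {y z : G}
    (hy : orderOf y = 2) (hz : z ^ 2 ≠ 1) : 3 * Nat.card G ≤ psi G + 1 := by
  classical
  have := Fintype.ofFinite G
  set g : G → ℕ := fun x => orderOf x + if x = 1 then 1 else 0 with hg
  have hsum : ∑ x, g x = psi G + 1 := by
    simp [hg, Finset.sum_add_distrib, psi_eq_sum]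
  have hshift (a : G) : ∑ x, g (a * x) = psi G + 1 :=
    (Equiv.sum_comp (Equiv.mulLeft a) g).trans hsum
  have hge2 (x : G) : 2 ≤ g x := by
    by_cases hx : x = 1
    · simp [hg, hx]
    · exact (two_le_orderOf_of_ne_one hx).trans (Nat.le_add_right _ _)
  have hge8 (x : G) (hx : x ^ 2 ≠ 1) : 8 ≤ g x + g (y * x) :=
    (eight_le_orderOf_add_orderOf_mul hy hx).trans
      (Nat.add_le_add (Nat.le_add_right _ _) (Nat.le_add_right _ _))
  have hpt (x : G) : 12 ≤ g x + g (y * x) + (g (z * x) + g (y * z * x)) := by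
    rw [mul_assoc y z x]
    by_cases hx : x ^ 2 = 1
    · have h8 := hge8 (z * x) (by rwa [mul_pow, hx, mul_one])
      have := hge2 x
      have := hge2 (y * x)
      omega
    · have h8 := hge8 x hx
      have := hge2 (z * x)
      have := hge2 (y * (z * x))
      omega
  have key := Finset.sum_le_sum fun x (_ : x ∈ Finset.univ) => hpt x
  simp only [Finset.sum_add_distrib, hsum, hshift, Finset.sum_const, Finset.card_univ,
    smul_eq_mul] at key
  rw [Nat.card_eq_fintype_card]
  omega

theorem three_mul_card_le_psi_add_two {G : Type*} [Group G] [Finite G]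
    (hG : ∀ x : G, orderOf x ≠ 2) : 3 * Nat.card G ≤ psi G + 2 := by
  classical
  have := Fintype.ofFinite G
  have hpt (x : G) : 3 ≤ orderOf x + if x = 1 then 2 else 0 := by
    by_cases hx : x = 1
    · simp [hx]
    · have := two_le_orderOf_of_ne_one hx
      have := hG x
      omega
  have key := Finset.sum_le_sum fun x (_ : x ∈ Finset.univ) => hpt x
  simp only [Finset.sum_add_distrib, Finset.sum_const, Finset.card_univ, smul_eq_mul,
    Finset.sum_ite_eq', Finset.mem_univ, if_true, ← psi_eq_sum] at key
  rw [Nat.card_eq_fintype_card]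
  omega

/-- A finite abelian group with `o(G) < 31/12` is either isomorphic to `C₃` or is an
elementary abelian `2`-group. -/
theorem stmt_5 (G : Type*) [CommGroup G] [Finite G] (h : avgOrder G < 31 / 12) :
    Nonempty (G ≃* Multiplicative (ZMod 3)) ∨ ∀ x : G, x ≠ 1 → orderOf x = 2 := by
  have hpos : 0 < Nat.card G := Nat.card_pos
  have hlt : 12 * psi G < 31 * Nat.card G := by
    rw [avgOrder, div_lt_div_iff₀ (by exact_mod_cast hpos) (by norm_num)] at h
    have h' : psi G * 12 < 31 * Nat.card G := by exact_mod_cast h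
    omega
  by_cases hinv : ∃ y : G, orderOf y = 2
  · obtain ⟨y, hy⟩ := hinv
    refine Or.inr fun z hz => orderOf_eq_prime ?_ hz
    by_contra hz2
    have := three_mul_card_le_psi_add_one hy hz2
    have := (three_le_orderOf_of_sq_ne_one hz2).trans (orderOf_le_card (x := z))
    omega
  · push Not at hinv
    have hpsi := three_mul_card_le_psi_add_two hinv
    have hodd : ¬ 2 ∣ Nat.card G := fun h2 =>
      let ⟨y, hy⟩ := exists_prime_orderOf_dvd_card' 2 h2
      hinv y hy
    obtain h1 | h3 : Nat.card G = 1 ∨ Nat.card G = 3 := by omega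
    · have := (Nat.card_eq_one_iff_unique.mp h1).1
      exact Or.inr fun x hx => (hx (Subsingleton.elim x 1)).elim
    · have : Fact (Nat.Prime 3) := ⟨Nat.prime_three⟩
      exact Or.inl ⟨mulEquivOfPrimeCardEq (p := 3) h3 (by simp)⟩
end

section
/- Let G be a finite 2-group with o(G) < 31/12. Then the commutator subgroup of G equals its Frattini subgroup, i.e. G' = Φ(G), and the number of elements of order 2 in G satisfies n_2(G) > (17/24)|G| − 3/2. -/
/-- A subgroup above the commutator subgroup that is maximal among those
avoiding `g` is a maximal subgroup, provided all squares lie in the commutator subgroup. -/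
theorem isCoatom_of_maximal_notMem {G : Type*} [Group G] (hsq : ∀ x : G, x ^ 2 ∈ commutator G)
    {g : G} {M : Subgroup G} (hM : Maximal (fun K => commutator G ≤ K ∧ g ∉ K) M) :
    IsCoatom M := by
  have hle := hM.prop.1
  have hg := hM.prop.2
  have : M.Normal := Subgroup.Normal.of_commutator_le G hle
  refine ⟨fun h => hg (h ▸ Subgroup.mem_top g), fun K hK => ?_⟩
  have hgK : g ∈ K := by
    by_contra hgK
    exact hK.not_ge (hM.le_of_ge ⟨hle.trans hK.le, hgK⟩ hK.le)
  rw [eq_top_iff]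
  intro y _
  by_cases hy : y ∈ M
  · exact hK.le hy
  have hgy : g ∈ M ⊔ Subgroup.zpowers y := by
    by_contra hgy
    exact hy (hM.le_of_ge ⟨hle.trans le_sup_left, hgy⟩ le_sup_left
      (Subgroup.mem_sup_right (Subgroup.mem_zpowers y)))
  obtain ⟨m, hm, z, hz, rfl⟩ := Subgroup.mem_sup_of_normal_left.mp hgy
  obtain ⟨k, rfl⟩ := Subgroup.mem_zpowers_iff.mp hz
  have heven : ∀ j : ℤ, y ^ (2 * j) ∈ M := fun j => by
    rw [zpow_mul]
    exact M.zpow_mem (by exact_mod_cast hle (hsq y)) j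
  obtain ⟨j, rfl | rfl⟩ := k.even_or_odd'
  · exact absurd (M.mul_mem hm (heven j)) hg
  · rw [zpow_add, zpow_one, ← mul_assoc] at hgK
    exact (K.mul_mem_cancel_left (hK.le (M.mul_mem hm (heven j)))).mp hgK

/-- The Frattini subgroup is contained in the commutator subgroup as soon as the latter contains
all squares. -/
theorem frattini_le_commutator_of_sq_mem {G : Type*} [Group G] [Finite G]
    (hsq : ∀ x : G, x ^ 2 ∈ commutator G) : frattini G ≤ commutator G := by
  intro g hg
  by_contra hgc
  obtain ⟨M, hM⟩ := (Set.toFinite {K : Subgroup G | commutator G ≤ K ∧ g ∉ K}).exists_maximal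
    ⟨commutator G, le_rfl, hgc⟩
  exact hM.prop.2 (frattini_le_coatom (isCoatom_of_maximal_notMem hsq hM) hg)

/-- In a nilpotent group, the commutator subgroup is contained in the Frattini subgroup. -/
theorem commutator_le_frattini {G : Type*} [Group G] [Group.IsNilpotent G] :
    commutator G ≤ frattini G := by
  refine le_iInf₂ fun M (hM : IsCoatom M) => ?_
  have hn : M.Normal := Subgroup.NormalizerCondition.normal_of_coatom M
    Group.normalizerCondition_of_isNilpotent hM
  have : Nontrivial (G ⧸ M) := QuotientGroup.nontrivial_iff.mpr hM.ne_top
  have hlt := Group.IsSolvable.commutator_lt_top_of_nontrivial (G ⧸ M)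
  have hMle : M ≤ (commutator (G ⧸ M)).comap (QuotientGroup.mk' M) := fun x hx => by
    rw [Subgroup.mem_comap, QuotientGroup.mk'_apply, (QuotientGroup.eq_one_iff x).mpr hx]
    exact one_mem _
  have hne : (commutator (G ⧸ M)).comap (QuotientGroup.mk' M) ≠ ⊤ := fun h => by
    rw [← Subgroup.comap_top (QuotientGroup.mk' M)] at h
    exact hlt.ne (Subgroup.comap_injective (QuotientGroup.mk'_surjective M) h)
  have hcomap := (hM.le_iff.mp hMle).resolve_left hne
  rw [← hcomap, ← Subgroup.map_le_iff_le_comap, commutator_def, Subgroup.map_commutator,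
    commutator_def]
  exact Subgroup.commutator_mono le_top le_top

/-- Elements of a finite `2`-group other than the identity and the involutions have order at
least `4`. -/
theorem four_mul_card_le_psi_add {G : Type*} [Group G] [Finite G] (hG : IsPGroup 2 G) :
    4 * Nat.card G ≤ psi G + 2 * nOrd G 2 + 3 := by
  classical
  have := Fintype.ofFinite G
  have hpt : ∀ x : G,
      4 ≤ orderOf x + (if orderOf x = 2 then 2 else 0) + (if x = 1 then 3 else 0) := by
    intro x
    obtain ⟨k, hk⟩ := IsPGroup.iff_orderOf.mp hG x
    match k with
    | 0 => simp [orderOf_eq_one_iff.mp (by simpa using hk)]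
    | 1 => simp [show orderOf x = 2 by simpa using hk]
    | k + 2 =>
      have := Nat.one_le_two_pow (n := k)
      rw [hk, pow_add]
      omega
  have hsum := Finset.sum_le_sum fun x (_ : x ∈ Finset.univ) => hpt x
  simp only [Finset.sum_add_distrib, Finset.sum_const, Finset.sum_ite_eq', ← Finset.sum_filter,
    Finset.mem_univ, if_true, Finset.card_univ, smul_eq_mul] at hsum
  rw [psi, finsum_eq_sum_of_fintype, nOrd, Nat.card_eq_fintype_card, Nat.card_eq_fintype_card,
    Fintype.card_subtype]
  omega

/-- If some square lies outside the commutator subgroup, then at most half of the elements of a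
finite group are the identity or involutions. -/
theorem two_mul_nOrd_two_add_one_le {G : Type*} [Group G] [Finite G] {x : G}
    (hx : x ^ 2 ∉ commutator G) : 2 * (nOrd G 2 + 1) ≤ Nat.card G := by
  let S : Subgroup G := ((powMonoidHom 2).comp (Abelianization.of (G := G))).ker
  have hS : ∀ y : G, y ∈ S ↔ y ^ 2 ∈ commutator G := fun y => by
    rw [← Abelianization.ker_of, MonoidHom.mem_ker, MonoidHom.mem_ker, map_pow]
    rfl
  have hindex : 2 ≤ S.index := by
    have h0 := S.index_ne_zero_of_finite
    have h1 : S.index ≠ 1 := fun h => hx <| (hS x).mp <| by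
      rw [Subgroup.index_eq_one.mp h]
      exact Subgroup.mem_top x
    omega
  have hcard : nOrd G 2 + 1 ≤ Nat.card S := by
    have hsub : insert 1 {y : G | orderOf y = 2} ⊆ (S : Set G) := by
      rintro y (rfl | hy)
      · exact S.one_mem
      · refine (hS y).mpr ?_
        rw [← show orderOf y = 2 from hy, pow_orderOf_eq_one]
        exact one_mem _
    have := Set.ncard_le_ncard hsub (Set.toFinite _)
    rwa [Set.ncard_insert_of_notMem (by simp) (Set.toFinite _)] at this
  calc 2 * (nOrd G 2 + 1) ≤ S.index * Nat.card S := Nat.mul_le_mul hindex hcard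
    _ = Nat.card G := S.index_mul_card

/-- A finite `2`-group with `o(G) < 31/12` satisfies `G' = Φ(G)` and
`n₂(G) > (17/24)|G| - 3/2`. -/
theorem stmt_6 (G : Type*) [Group G] [Finite G] (h2 : ∃ k : ℕ, Nat.card G = 2 ^ k)
    (h : avgOrder G < 31 / 12) :
    commutator G = frattini G ∧
      (nOrd G 2 : ℚ) > 17 / 24 * (Nat.card G : ℚ) - 3 / 2 := by
  obtain ⟨k, hk⟩ := h2
  have : Fact (Nat.Prime 2) := ⟨Nat.prime_two⟩
  have hG : IsPGroup 2 G := IsPGroup.of_card hk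
  have hpos : (0 : ℚ) < Nat.card G := by exact_mod_cast Nat.card_pos
  rw [avgOrder, div_lt_iff₀ hpos] at h
  have hpsi : (4 * Nat.card G : ℚ) ≤ psi G + 2 * nOrd G 2 + 3 := by
    exact_mod_cast four_mul_card_le_psi_add hG
  have hn2 : (nOrd G 2 : ℚ) > 17 / 24 * (Nat.card G : ℚ) - 3 / 2 := by linarith
  refine ⟨?_, hn2⟩
  have hsq : ∀ x : G, x ^ 2 ∈ commutator G := by
    by_contra! ⟨x, hx⟩
    have hhalf : (2 * (nOrd G 2 + 1) : ℚ) ≤ Nat.card G := by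
      exact_mod_cast two_mul_nOrd_two_add_one_le hx
    have hlt : Nat.card G < 3 := by
      have : (Nat.card G : ℚ) < 3 := by linarith
      exact_mod_cast this
    have hdvd : Nat.card G ∣ 2 := by
      have := Nat.card_pos (α := G)
      interval_cases Nat.card G <;> simp
    exact hx <| by
      rw [orderOf_dvd_iff_pow_eq_one.mp ((orderOf_dvd_natCard x).trans hdvd)]
      exact one_mem _
  have : Group.IsNilpotent G := hG.isNilpotent
  exact le_antisymm commutator_le_frattini (frattini_le_commutator_of_sq_mem hsq)
end

section
/- Let G be a finite supersolvable group of even order which is not a 2-group and which satisfies o(G) < 31/12. Then G contains a normal elementary abelian 3-subgroup K of order 3^m (for some m ≥ 1) of index 2 such that every element of G outside K has order 2 (so G is a Frobenius group with kernel K and cyclic complement of order 2), and o(G) = (5·3^m − 2)/(2·3^m). -/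
/-- `HasNormalTwoComplement G`: some normal subgroup of odd order has index a power of two. -/
def HasNormalTwoComplement (G : Type*) [Group G] : Prop :=
  ∃ K : Subgroup G, K.Normal ∧ Odd (Nat.card K) ∧ ∃ a : ℕ, K.index = 2 ^ a

theorem mem_of_odd_orderOf_of_index_eq_two_pow {G : Type*} [Group G] {N : Subgroup G} [N.Normal]
    {a : ℕ} (hN : N.index = 2 ^ a) {x : G} (hx : Odd (orderOf x)) : x ∈ N := by
  have h1 : orderOf (x : G ⧸ N) ∣ orderOf x := orderOf_map_dvd (QuotientGroup.mk' N) x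
  have h2 : orderOf (x : G ⧸ N) ∣ 2 ^ a := by
    rw [← hN, Subgroup.index_eq_card]
    exact orderOf_dvd_natCard _
  have h3 : orderOf (x : G ⧸ N) = 1 :=
    Nat.eq_one_of_dvd_coprimes (Nat.Coprime.pow_right a hx.coprime_two_right) h1 h2
  exact (QuotientGroup.eq_one_iff x).1 (orderOf_eq_one_iff.1 h3)

/-- A finite group with cyclic Sylow `2`-subgroups has a normal `2`-complement. -/
theorem HasNormalTwoComplement.of_isCyclic_sylow {G : Type*} [Group G] [Finite G] (P : Sylow 2 G)
    (hP : IsCyclic P) : HasNormalTwoComplement G := by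
  by_cases hodd : Odd (Nat.card G)
  · exact ⟨⊤, inferInstance, by simpa using hodd, 0, by simp⟩
  have hmin : (Nat.card G).minFac = 2 :=
    (Nat.minFac_eq_two_iff _).2 (Nat.not_odd_iff_even.1 hodd).two_dvd
  have hle := hP.normalizer_le_centralizer hmin
  refine ⟨(MonoidHom.transferSylow P hle).ker, inferInstance, ?_, ?_⟩
  · rw [← Nat.not_even_iff_odd, even_iff_two_dvd]
    exact MonoidHom.not_dvd_card_ker_transferSylow P hle
  · obtain ⟨a, ha⟩ := P.2.exists_card_eq
    exact ⟨a, (MonoidHom.ker_transferSylow_isComplement' P hle).symm.index_eq_card.trans ha⟩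

theorem HasNormalTwoComplement.of_normal_subgroup {G : Type*} [Group G] [Finite G]
    {L : Subgroup G} [L.Normal] {a : ℕ} (ha : L.index = 2 ^ a) (hL : HasNormalTwoComplement L) :
    HasNormalTwoComplement G := by
  obtain ⟨N, hN, hodd, b, hb⟩ := hL
  refine ⟨N.map L.subtype, ⟨?_⟩, ?_, b + a, ?_⟩
  · rintro _ ⟨x, hx, rfl⟩ g
    have hmem : g * L.subtype x * g⁻¹ ∈ L := Subgroup.Normal.conj_mem inferInstance _ x.2 g
    refine ⟨⟨_, hmem⟩, mem_of_odd_orderOf_of_index_eq_two_pow hb ?_, rfl⟩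
    have h1 : orderOf (⟨_, hmem⟩ : L) = orderOf x := by
      rw [Subgroup.orderOf_mk, ← Subgroup.orderOf_coe x]
      exact (MulAut.conj g).orderOf_eq (x : G)
    rw [h1]
    exact hodd.of_dvd_nat (Subgroup.orderOf_dvd_natCard N hx)
  · rwa [Subgroup.card_subtype]
  · rw [Subgroup.index_map_subtype, ha, hb, pow_add]

theorem HasNormalTwoComplement.of_surjective {G H : Type*} [Group G] [Finite G] [Group H]
    (f : G →* H) (hf : Function.Surjective f) (hker : IsCyclic f.ker)
    (hH : HasNormalTwoComplement H) : HasNormalTwoComplement G := by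
  obtain ⟨M, hM, hodd, a, ha⟩ := hH
  have : Finite H := Finite.of_surjective f hf
  refine .of_normal_subgroup (L := M.comap f) (a := a)
    (by rw [Subgroup.index_comap_of_surjective _ hf, ha]) ?_
  let P : Sylow 2 (M.comap f) := default
  refine .of_isCyclic_sylow P ?_
  have hPker : ∀ x ∈ P, f x = 1 := by
    intro x hx
    obtain ⟨k, hk⟩ := P.2.exists_card_eq
    have h1 : orderOf (f x) ∣ 2 ^ k := by
      refine (orderOf_map_dvd f (x : G)).trans ?_
      rw [Subgroup.orderOf_coe, ← hk]
      exact Subgroup.orderOf_dvd_natCard _ hx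
    have h2 : orderOf (f x) ∣ Nat.card M := Subgroup.orderOf_dvd_natCard M x.2
    exact orderOf_eq_one_iff.1
      (Nat.eq_one_of_dvd_coprimes (Nat.Coprime.pow_right k hodd.coprime_two_right) h2 h1)
  refine isCyclic_of_injective
    (((M.comap f).subtype.comp P.toSubgroup.subtype).codRestrict f.ker
      fun x => hPker x x.2) ?_
  intro x y hxy
  exact Subtype.ext (Subtype.ext (congrArg (fun z : f.ker => (z : G)) hxy))

theorem IsSupersolvable.hasNormalTwoComplement {G : Type*} [Group G] [Finite G]
    (h : IsSupersolvable G) : HasNormalTwoComplement G := by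
  obtain ⟨n, H, hnorm, h0, hn, hle, hcyc⟩ := h
  have key : ∀ i : Fin (n + 1), HasNormalTwoComplement (G ⧸ H i) := by
    intro i
    induction i using Fin.reverseInduction with
    | last =>
      have : Subsingleton (G ⧸ H (Fin.last n)) := by
        rw [hn]; exact QuotientGroup.subsingleton_quotient_top
      exact ⟨⊤, inferInstance, by simp, 0, by simp⟩
    | cast i ih =>
      have hle' : H i.castSucc ≤ (H i.succ).comap (MonoidHom.id G) := hle i
      refine .of_surjective (QuotientGroup.map _ _ (MonoidHom.id G) hle')
        (QuotientGroup.map_surjective_of_surjective _ _ _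
          (QuotientGroup.mk_surjective) _) ?_ ih
      have hnor := (hnorm i.castSucc).subgroupOf (H i.succ)
      have := hcyc i
      let φ : ↥(H i.succ) ⧸ (H i.castSucc).subgroupOf (H i.succ) →* G ⧸ H i.castSucc :=
        QuotientGroup.map _ _ (H i.succ).subtype le_rfl
      have hφ : (QuotientGroup.map _ _ (MonoidHom.id G) hle').ker ≤ φ.range := by
        rw [QuotientGroup.ker_map]
        rintro _ ⟨x, hx, rfl⟩
        exact ⟨QuotientGroup.mk ⟨x, hx⟩, rfl⟩
      have h1 : IsCyclic φ.range :=
        isCyclic_of_surjective φ.rangeRestrict φ.rangeRestrict_surjective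
      exact isCyclic_of_injective (Subgroup.inclusion hφ) (Subgroup.inclusion_injective hφ)
  refine .of_surjective (QuotientGroup.mk' (H 0)) (QuotientGroup.mk'_surjective _) ?_ (key 0)
  rw [QuotientGroup.ker_mk', h0]
  infer_instance

section Cosets

variable {G : Type*} [Group G] [Fintype G] {K : Subgroup G}

open Classical in
/-- The elements of `G` lying over a given coset of `K`. -/
noncomputable def cosetFinset (K : Subgroup G) (q : G ⧸ K) : Finset G :=
  Finset.univ.filter fun x => (x : G ⧸ K) = q

@[simp]
theorem mem_cosetFinset {q : G ⧸ K} {x : G} : x ∈ cosetFinset K q ↔ (x : G ⧸ K) = q := by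
  simp [cosetFinset]

variable [K.Normal]

theorem mem_cosetFinset_one {x : G} : x ∈ cosetFinset K 1 ↔ x ∈ K := by
  rw [mem_cosetFinset, QuotientGroup.eq_one_iff]

theorem card_cosetFinset (q : G ⧸ K) : (cosetFinset K q).card = Nat.card K := by
  have h1 : Nat.card K = (cosetFinset K 1).card :=
    Nat.subtype_card _ fun x => mem_cosetFinset_one
  obtain ⟨x, rfl⟩ := QuotientGroup.mk_surjective q
  rw [h1]
  refine Finset.card_nbij' (fun y => x⁻¹ * y) (fun y => x * y) ?_ ?_ ?_ ?_
  · intro y hy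
    rw [SetLike.mem_coe, mem_cosetFinset] at hy
    rw [SetLike.mem_coe, mem_cosetFinset, QuotientGroup.mk_mul, QuotientGroup.mk_inv, hy,
      inv_mul_cancel]
  · intro y hy
    rw [SetLike.mem_coe, mem_cosetFinset] at hy
    rw [SetLike.mem_coe, mem_cosetFinset, QuotientGroup.mk_mul, hy, mul_one]
  · intro y _
    simp
  · intro y _
    simp

omit [K.Normal] in
theorem sum_cosetFinset [Fintype (G ⧸ K)] (f : G → ℕ) :
    ∑ q, ∑ x ∈ cosetFinset K q, f x = ∑ x, f x := by
  classical
  convert Finset.sum_fiberwise Finset.univ (fun x : G => (x : G ⧸ K)) f using 3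
  simp [cosetFinset]

omit [Fintype G] [K.Normal] in
theorem odd_orderOf_of_mem (hodd : Odd (Nat.card K)) {x : G} (hx : x ∈ K) : Odd (orderOf x) :=
  hodd.of_dvd_nat (Subgroup.orderOf_dvd_natCard K hx)

theorem three_le_orderOf_of_odd {G : Type*} [Group G] {x : G} (hx : Odd (orderOf x))
    (hx1 : x ≠ 1) : 3 ≤ orderOf x := by
  have h1 : orderOf x ≠ 1 := fun h => hx1 (orderOf_eq_one_iff.1 h)
  obtain ⟨r, hr⟩ := hx
  omega

/-- A lower bound for the sum of the orders over a finset containing `1`. -/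
theorem mul_card_le_sum_orderOf_of_one_mem {G : Type*} [Group G] {s : Finset G} {c : ℕ}
    (h1 : 1 ∈ s) (h : ∀ x ∈ s, x ≠ 1 → c + 1 ≤ orderOf x) :
    (c + 1) * s.card ≤ (∑ x ∈ s, orderOf x) + c := by
  classical
  rw [← Finset.add_sum_erase s _ h1, orderOf_one]
  have h2 : (s.erase 1).card • (c + 1) ≤ ∑ x ∈ s.erase 1, orderOf x :=
    Finset.card_nsmul_le_sum _ _ _ fun x hx =>
      h x (Finset.mem_of_mem_erase hx) (Finset.ne_of_mem_erase hx)
  have h3 := Finset.card_erase_add_one h1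
  rw [← h3]
  rw [smul_eq_mul] at h2
  linarith

theorem three_mul_card_le_sum_orderOf (hodd : Odd (Nat.card K)) :
    3 * Nat.card K ≤ (∑ x ∈ cosetFinset K 1, orderOf x) + 2 := by
  rw [← card_cosetFinset (1 : G ⧸ K)]
  refine mul_card_le_sum_orderOf_of_one_mem (mem_cosetFinset_one.2 K.one_mem) fun x hx hx1 => ?_
  exact three_le_orderOf_of_odd (odd_orderOf_of_mem hodd (mem_cosetFinset_one.1 hx)) hx1

theorem two_mul_card_le_sum_orderOf {q : G ⧸ K} (hq : q ≠ 1) :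
    2 * Nat.card K ≤ ∑ x ∈ cosetFinset K q, orderOf x := by
  rw [← card_cosetFinset q, mul_comm]
  refine Finset.card_nsmul_le_sum _ orderOf 2 fun x hx => ?_
  have h1 : orderOf x ≠ 1 := fun h =>
    hq (by rw [← mem_cosetFinset.1 hx, orderOf_eq_one_iff.1 h, QuotientGroup.mk_one])
  have := orderOf_pos x
  omega

/-- All elements of the coset `q` are involutions. -/
def IsInvolutionCoset (K : Subgroup G) (q : G ⧸ K) : Prop :=
  ∀ x : G, (x : G ⧸ K) = q → orderOf x = 2

/-- If some element of an involution of `G` centralizes no nontrivial element of `K`, then its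
coset consists of involutions. -/
theorem isInvolutionCoset_of_centralizer {y : G} (hy : orderOf y = 2)
    (hc : ∀ c ∈ K, Commute y c → c = 1) : IsInvolutionCoset K (y : G ⧸ K) := by
  intro x hx
  have hinj : Set.InjOn (fun k => k * y * k⁻¹) (cosetFinset K (1 : G ⧸ K)) := by
    intro k hk l hl hkl
    rw [SetLike.mem_coe, mem_cosetFinset_one] at hk hl
    have h1 : y * (l⁻¹ * k) = (l⁻¹ * k) * y := by
      have h2 : k * y * k⁻¹ = l * y * l⁻¹ := hkl
      calc y * (l⁻¹ * k) = l⁻¹ * (l * y * l⁻¹) * k := by group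
        _ = l⁻¹ * (k * y * k⁻¹) * k := by rw [h2]
        _ = (l⁻¹ * k) * y := by group
    exact (inv_mul_eq_one.1 (hc _ (K.mul_mem (K.inv_mem hl) hk) h1)).symm
  have hmaps : Set.MapsTo (fun k => k * y * k⁻¹) (cosetFinset K (1 : G ⧸ K))
      (cosetFinset K (y : G ⧸ K)) := by
    intro k hk
    rw [SetLike.mem_coe, mem_cosetFinset] at hk
    rw [SetLike.mem_coe, mem_cosetFinset]
    simp [hk]
  have hsurj := Finset.surjOn_of_injOn_of_card_le _ hmaps hinj
    (by rw [card_cosetFinset, card_cosetFinset])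
  obtain ⟨k, -, rfl⟩ := hsurj (SetLike.mem_coe.2 (mem_cosetFinset.2 hx))
  exact ((MulAut.conj k).orderOf_eq y).trans hy

theorem four_mul_card_le_sum_orderOf (hodd : Odd (Nat.card K)) {a : ℕ} (ha : K.index = 2 ^ a)
    {q : G ⧸ K} (hq1 : q ≠ 1) (hq : ¬ IsInvolutionCoset K q) :
    4 * Nat.card K ≤ ∑ x ∈ cosetFinset K q, orderOf x := by
  classical
  have hdvd : ∀ x ∈ cosetFinset K q, orderOf q ∣ orderOf x := by
    intro x hx
    rw [← mem_cosetFinset.1 hx]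
    exact orderOf_map_dvd (QuotientGroup.mk' K) x
  obtain ⟨j, -, hj⟩ : ∃ j ≤ a, orderOf q = 2 ^ j := by
    rw [← Nat.dvd_prime_pow Nat.prime_two, ← ha, Subgroup.index_eq_card]
    exact orderOf_dvd_natCard q
  rcases j with - | - | j
  · exact absurd (orderOf_eq_one_iff.1 hj) hq1
  · have hoq : orderOf q = 2 := hj
    set I := (cosetFinset K q).filter fun x => orderOf x = 2 with hI
    set N := (cosetFinset K q).filter fun x => ¬ orderOf x = 2 with hN
    have hex : ∀ y ∈ I, ∃ c ∈ K, Commute y c ∧ c ≠ 1 := by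
      intro y hy
      rw [hI, Finset.mem_filter, mem_cosetFinset] at hy
      by_contra! hcon
      exact hq (hy.1 ▸ isInvolutionCoset_of_centralizer hy.2 hcon)
    choose! c hcK hcomm hc1 using hex
    obtain ⟨r, hr⟩ := hodd
    have hpow : ∀ z ∈ K, z ^ (2 * r + 1) = 1 := fun z hz => by
      rw [← hr]
      exact orderOf_dvd_iff_pow_eq_one.1 (Subgroup.orderOf_dvd_natCard K hz)
    have hIN : I.card ≤ N.card := by
      refine Finset.card_le_card_of_injOn (fun y => y * c y) ?_ ?_
      · intro y hy
        have hy' := hy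
        rw [SetLike.mem_coe, hI, Finset.mem_filter, mem_cosetFinset] at hy'
        rw [SetLike.mem_coe, hN, Finset.mem_filter, mem_cosetFinset]
        refine ⟨?_, fun h => hc1 y hy ?_⟩
        · rw [QuotientGroup.mk_mul, (QuotientGroup.eq_one_iff _).2 (hcK y hy), mul_one, hy'.1]
        · have h1 := pow_orderOf_eq_one (y * c y)
          have h2 := pow_orderOf_eq_one y
          rw [hy'.2] at h2
          rw [h, (hcomm y hy).mul_pow, h2, one_mul] at h1
          have h3 := hpow _ (hcK y hy)
          rwa [pow_succ, pow_mul, h1, one_pow, one_mul] at h3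
      · have hrec : ∀ y ∈ I, (y * c y) ^ (2 * r + 1) = y := by
          intro y hy
          have hy' := hy
          rw [hI, Finset.mem_filter] at hy'
          have h2 := pow_orderOf_eq_one y
          rw [hy'.2] at h2
          rw [(hcomm y hy).mul_pow, hpow _ (hcK y hy), mul_one, pow_succ, pow_mul, h2, one_pow,
            one_mul]
        intro y hy z hz hyz
        rw [← hrec y hy, ← hrec z hz]
        exact congrArg (· ^ (2 * r + 1)) hyz
    have hcard : I.card + N.card = Nat.card K := by
      rw [← card_cosetFinset q]
      exact Finset.card_filter_add_card_filter_not _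
    have hsum : ∑ x ∈ I, orderOf x + ∑ x ∈ N, orderOf x = ∑ x ∈ cosetFinset K q, orderOf x :=
      Finset.sum_filter_add_sum_filter_not _ _ _
    have h1 : I.card • 2 ≤ ∑ x ∈ I, orderOf x :=
      Finset.card_nsmul_le_sum _ _ _ fun x hx => (Finset.mem_filter.1 hx).2.ge
    have h2 : N.card • 6 ≤ ∑ x ∈ N, orderOf x := by
      refine Finset.card_nsmul_le_sum _ _ _ fun x hx => ?_
      obtain ⟨hx, hx2⟩ := Finset.mem_filter.1 hx
      obtain ⟨m, hm⟩ := hoq ▸ hdvd x hx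
      have hsq : x ^ 2 ∈ K := by
        rw [← QuotientGroup.eq_one_iff, QuotientGroup.mk_pow, mem_cosetFinset.1 hx, ← hoq,
          pow_orderOf_eq_one]
      have hmo : orderOf (x ^ 2) = m := by
        rw [orderOf_pow_of_dvd two_ne_zero ⟨m, hm⟩, hm]
        omega
      have hpos := orderOf_pos x
      obtain ⟨s, hs⟩ := odd_orderOf_of_mem ⟨r, hr⟩ hsq
      omega
    rw [smul_eq_mul] at h1 h2
    omega
  · rw [← card_cosetFinset q, mul_comm]
    refine Finset.card_nsmul_le_sum _ _ _ fun x hx => Nat.le_of_dvd (orderOf_pos x) ?_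
    refine dvd_trans ?_ (hdvd x hx)
    rw [hj]
    exact pow_dvd_pow 2 (by omega : 2 ≤ j + 1 + 1)

omit [Fintype G] in
theorem IsInvolutionCoset.conj_eq_inv {x k : G} (hx : IsInvolutionCoset K (x : G ⧸ K))
    (hk : k ∈ K) : x * k * x⁻¹ = k⁻¹ := by
  have h1 := pow_orderOf_eq_one x
  rw [hx x rfl] at h1
  have h2 := pow_orderOf_eq_one (x * k)
  rw [hx (x * k) (by rw [QuotientGroup.mk_mul, (QuotientGroup.eq_one_iff _).2 hk, mul_one])] at h2
  rw [sq] at h1 h2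
  rw [inv_eq_of_mul_eq_one_left h1, eq_inv_iff_mul_eq_one, mul_assoc]
  exact h2

omit [Fintype G] in
theorem not_isInvolutionCoset_mul (hodd : Odd (Nat.card K)) (hK : K ≠ ⊥) {p q : G ⧸ K}
    (hp : IsInvolutionCoset K p) (hq : IsInvolutionCoset K q) :
    ¬ IsInvolutionCoset K (p * q) := by
  obtain ⟨x, rfl⟩ := QuotientGroup.mk_surjective p
  obtain ⟨y, rfl⟩ := QuotientGroup.mk_surjective q
  intro hpq
  refine hK ((Subgroup.eq_bot_iff_forall K).2 fun k hk => ?_)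
  have h1 := hpq.conj_eq_inv (x := x * y) hk
  have h2 : x * y * k * (x * y)⁻¹ = k := by
    calc x * y * k * (x * y)⁻¹ = x * (y * k * y⁻¹) * x⁻¹ := by group
      _ = k := by rw [hq.conj_eq_inv hk, hp.conj_eq_inv (K.inv_mem hk), inv_inv]
  have h3 : k ^ 2 = 1 := by
    rw [sq]
    nth_rewrite 1 [← h2, h1]
    exact inv_mul_cancel k
  exact orderOf_eq_one_iff.1 (Nat.eq_one_of_dvd_coprimes
    (odd_orderOf_of_mem hodd hk).coprime_two_right dvd_rfl (orderOf_dvd_of_pow_eq_one h3))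

end Cosets

section AverageOrder

theorem twelve_mul_psi_lt {G : Type*} [Group G] [Finite G] (h : avgOrder G < 31 / 12) :
    12 * psi G < 31 * Nat.card G := by
  have hpos : (0 : ℚ) < Nat.card G := by exact_mod_cast Nat.card_pos
  rw [avgOrder, div_lt_div_iff₀ hpos (by norm_num)] at h
  have : psi G * 12 < 31 * Nat.card G := by exact_mod_cast h
  omega

variable {G : Type*} [Group G] [Fintype G] {K : Subgroup G} [K.Normal]

theorem index_eq_two_of_psi_lt (hodd : Odd (Nat.card K)) (hK : 3 ≤ Nat.card K) {a : ℕ}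
    (ha : K.index = 2 ^ a) (heven : 2 ∣ Nat.card G) (h : 12 * psi G < 31 * Nat.card G) :
    K.index = 2 ∧ ∃ q : G ⧸ K, IsInvolutionCoset K q := by
  classical
  have hbot : K ≠ ⊥ := by
    rintro rfl
    simp at hK
  set S : Finset (G ⧸ K) := Finset.univ.filter (IsInvolutionCoset K) with hS
  have hn : Fintype.card (G ⧸ K) = K.index := by
    rw [Subgroup.index_eq_card, Nat.card_eq_fintype_card]
  have hcoset : ∀ q : G ⧸ K, 4 * Nat.card K ≤ (∑ x ∈ cosetFinset K q, orderOf x) +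
      ((if IsInvolutionCoset K q then 2 * Nat.card K else 0) +
        if q = 1 then Nat.card K + 2 else 0) := by
    intro q
    by_cases hq1 : q = 1
    · subst hq1
      have := three_mul_card_le_sum_orderOf hodd
      simp only [if_true]
      omega
    · by_cases hq : IsInvolutionCoset K q
      · have := two_mul_card_le_sum_orderOf hq1
        simp only [hq, if_true]
        omega
      · have := four_mul_card_le_sum_orderOf hodd ha hq1 hq
        omega
  have hsum := Finset.sum_le_sum fun q (_ : q ∈ Finset.univ) => hcoset q
  rw [Finset.sum_add_distrib, Finset.sum_add_distrib, sum_cosetFinset, ← psi_eq_sum,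
    ← Finset.sum_filter, ← hS, Finset.sum_const, Finset.sum_const, Finset.sum_ite_eq' _ _,
    Finset.card_univ, hn, smul_eq_mul, smul_eq_mul, if_pos (Finset.mem_univ _)] at hsum
  have hSn : 2 * S.card ≤ K.index := by
    rcases S.eq_empty_or_nonempty with hemp | ⟨t, ht⟩
    · simp [hemp]
    have hdisj : Disjoint S (S.image (t * ·)) := by
      rw [Finset.disjoint_right]
      intro q hq hqS
      obtain ⟨p, hp, rfl⟩ := Finset.mem_image.1 hq
      exact not_isInvolutionCoset_mul hodd hbot (Finset.mem_filter.1 ht).2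
        (Finset.mem_filter.1 hp).2 (Finset.mem_filter.1 hqS).2
    have hcard := Finset.card_le_univ (S ∪ S.image (t * ·))
    rw [Finset.card_union_of_disjoint hdisj,
      Finset.card_image_of_injective _ (mul_right_injective t), hn] at hcard
    omega
  rw [← Subgroup.card_mul_index K] at h
  have hidx : K.index = 2 := by
    rcases a with - | - | a
    · rw [← Subgroup.card_mul_index K, ha, pow_zero, mul_one] at heven
      exact absurd (even_iff_two_dvd.2 heven) (Nat.not_even_iff_odd.2 hodd)
    · simpa using ha
    · have h4 : 4 ≤ K.index := by
        rw [ha]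
        exact Nat.pow_le_pow_right two_pos (by omega : 2 ≤ a + 1 + 1)
      nlinarith [Nat.mul_le_mul_left (Nat.card K) hSn, Nat.mul_le_mul_left (Nat.card K) h4]
  refine ⟨hidx, ?_⟩
  by_contra! hno
  have hS0 : S.card = 0 := by
    rw [Finset.card_eq_zero, hS, Finset.filter_eq_empty_iff]
    exact fun q _ => hno q
  rw [hidx] at h hsum
  rw [hS0] at hsum
  omega

omit [Fintype G] in
theorem IsInvolutionCoset.mul_comm_of_mem {q : G ⧸ K} (hq : IsInvolutionCoset K q) {x y : G}
    (hx : x ∈ K) (hy : y ∈ K) : x * y = y * x := by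
  obtain ⟨t, rfl⟩ := QuotientGroup.mk_surjective q
  refine inv_injective ?_
  rw [mul_inv_rev y, ← hq.conj_eq_inv (K.mul_mem hx hy), ← hq.conj_eq_inv hx,
    ← hq.conj_eq_inv hy]
  group

theorem psi_eq_of_index_eq_two (hidx : K.index = 2) {q : G ⧸ K} (hq : IsInvolutionCoset K q) :
    (∀ x : G, x ∉ K → orderOf x = 2) ∧
      psi G = (∑ x ∈ cosetFinset K 1, orderOf x) + 2 * Nat.card K := by
  classical
  have hq1 : q ≠ 1 := by
    rintro rfl
    simpa using hq 1 (QuotientGroup.mk_one K)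
  have hcard : Fintype.card (G ⧸ K) = 2 := by
    rw [← Nat.card_eq_fintype_card, ← Subgroup.index_eq_card, hidx]
  have huniv : ({1, q} : Finset (G ⧸ K)) = Finset.univ :=
    Finset.eq_univ_of_card _ (by rw [Finset.card_pair hq1.symm, hcard])
  have hall : ∀ p : G ⧸ K, p = 1 ∨ p = q := fun p => by
    have := Finset.mem_univ p
    rw [← huniv] at this
    simpa using this
  refine ⟨fun x hx => ?_, ?_⟩
  · exact hq x ((hall x).resolve_left fun h => hx ((QuotientGroup.eq_one_iff x).1 h))
  · rw [psi_eq_sum, ← sum_cosetFinset (K := K), ← huniv, Finset.sum_pair hq1.symm,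
      Finset.sum_congr rfl fun x hx => hq x (mem_cosetFinset.1 hx), Finset.sum_const,
      card_cosetFinset, smul_eq_mul, mul_comm 2]

/-- A commutative normal subgroup of odd order whose elements have small average order
has exponent dividing `3`. -/
theorem pow_three_eq_one_of_sum_orderOf_lt (hodd : Odd (Nat.card K)) (hK : 3 ≤ Nat.card K)
    (hcomm : ∀ x ∈ K, ∀ y ∈ K, x * y = y * x)
    (h : 6 * ∑ x ∈ cosetFinset K 1, orderOf x < 19 * Nat.card K) : ∀ x ∈ K, x ^ 3 = 1 := by
  classical
  let T : Subgroup G :=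
    { carrier := {x | x ∈ K ∧ x ^ 3 = 1}
      one_mem' := ⟨K.one_mem, one_pow 3⟩
      mul_mem' := fun {x y} hx hy => ⟨K.mul_mem hx.1 hy.1, by
        rw [(show Commute x y from hcomm x hx.1 y hy.1).mul_pow, hx.2, hy.2, one_mul]⟩
      inv_mem' := fun {x} hx => ⟨K.inv_mem hx.1, by rw [inv_pow, hx.2, inv_one]⟩ }
  have hT : ∀ x, x ∈ T ↔ x ∈ K ∧ x ^ 3 = 1 := fun x => Iff.rfl
  have hTK : T ≤ K := fun x hx => hx.1
  by_contra hne
  have hrel : T.relIndex K ≠ 1 := fun h1 =>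
    hne fun x hx => (Subgroup.relIndex_eq_one.1 h1 hx).2
  have hmul : T.relIndex K * Nat.card T = Nat.card K := by
    rw [← Subgroup.relIndex_bot_left, ← Subgroup.relIndex_bot_left, mul_comm]
    exact Subgroup.relIndex_mul_relIndex _ _ _ bot_le hTK
  have h3 : 3 ≤ T.relIndex K := by
    obtain ⟨r, hr⟩ := hodd.of_dvd_nat (Dvd.intro _ hmul)
    omega
  have h3T : 3 * Nat.card T ≤ Nat.card K := hmul ▸ Nat.mul_le_mul_right _ h3
  set A := (cosetFinset K (1 : G ⧸ K)).filter fun x => x ^ 3 = 1 with hA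
  set B := (cosetFinset K (1 : G ⧸ K)).filter fun x => ¬ x ^ 3 = 1 with hB
  have hAT : Nat.card T = A.card :=
    Nat.subtype_card _ fun x => by rw [hA, Finset.mem_filter, mem_cosetFinset_one]; rfl
  have hcard : A.card + B.card = Nat.card K := by
    rw [← card_cosetFinset (1 : G ⧸ K)]
    exact Finset.card_filter_add_card_filter_not _
  have hsum : ∑ x ∈ A, orderOf x + ∑ x ∈ B, orderOf x =
      ∑ x ∈ cosetFinset K (1 : G ⧸ K), orderOf x :=
    Finset.sum_filter_add_sum_filter_not _ _ _
  have hoddK : ∀ x ∈ cosetFinset K (1 : G ⧸ K), Odd (orderOf x) := fun x hx =>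
    odd_orderOf_of_mem hodd (mem_cosetFinset_one.1 hx)
  have h1 : (2 + 1) * A.card ≤ (∑ x ∈ A, orderOf x) + 2 :=
    mul_card_le_sum_orderOf_of_one_mem (by simp [hA]) fun x hx hx1 =>
      three_le_orderOf_of_odd (hoddK x (Finset.mem_filter.1 hx).1) hx1
  have h2 : B.card • 5 ≤ ∑ x ∈ B, orderOf x := by
    refine Finset.card_nsmul_le_sum _ _ _ fun x hx => ?_
    obtain ⟨hx, hx3⟩ := Finset.mem_filter.1 hx
    have h4 : 3 ≤ orderOf x := three_le_orderOf_of_odd (hoddK x hx) (by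
      rintro rfl
      exact hx3 (one_pow 3))
    have h5 : orderOf x ≠ 3 := fun h5 => hx3 (by rw [← h5, pow_orderOf_eq_one])
    obtain ⟨r, hr⟩ := hoddK x hx
    omega
  rw [smul_eq_mul] at h2
  omega

theorem sum_orderOf_of_pow_three_eq_one (hK : ∀ x ∈ K, x ≠ 1 → orderOf x = 3) :
    (∑ x ∈ cosetFinset K 1, orderOf x) + 2 = 3 * Nat.card K := by
  classical
  have h1 : (1 : G) ∈ cosetFinset K 1 := mem_cosetFinset_one.2 K.one_mem
  rw [← card_cosetFinset (1 : G ⧸ K), ← Finset.add_sum_erase _ _ h1, orderOf_one,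
    Finset.sum_congr rfl fun x hx => hK x (mem_cosetFinset_one.1 (Finset.mem_of_mem_erase hx))
      (Finset.ne_of_mem_erase hx), Finset.sum_const, smul_eq_mul]
  have := Finset.card_erase_add_one h1
  omega

end AverageOrder

/-- A finite supersolvable group of even order which is not a `2`-group and satisfies
`o(G) < 31/12` has a normal elementary abelian `3`-subgroup `K` of order `3 ^ m`
(`m ≥ 1`) and index `2`, all elements outside `K` have order `2`, and
`o(G) = (5 · 3 ^ m - 2)/(2 · 3 ^ m)`. -/
theorem stmt_7 (G : Type*) [Group G] [Finite G] (hss : IsSupersolvable G)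
    (heven : 2 ∣ Nat.card G) (hnot2 : ¬∃ k : ℕ, Nat.card G = 2 ^ k)
    (h : avgOrder G < 31 / 12) :
    ∃ (m : ℕ) (K : Subgroup G), 1 ≤ m ∧ K.Normal ∧
      Nat.card K = 3 ^ m ∧ K.index = 2 ∧
      (∀ x ∈ K, ∀ y ∈ K, x * y = y * x) ∧
      (∀ x ∈ K, x ≠ 1 → orderOf x = 3) ∧
      (∀ x : G, x ∉ K → orderOf x = 2) ∧
      avgOrder G = (5 * 3 ^ m - 2 : ℚ) / (2 * 3 ^ m) := by
  have := Fintype.ofFinite G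
  obtain ⟨K, hKn, hodd, a, ha⟩ := hss.hasNormalTwoComplement
  have hlt := twelve_mul_psi_lt h
  have hcardG := Subgroup.card_mul_index K
  have hK : 3 ≤ Nat.card K := by
    have h1 : Nat.card K ≠ 1 := fun h1 => hnot2 ⟨a, by rw [← hcardG, h1, ha, one_mul]⟩
    obtain ⟨r, hr⟩ := hodd
    omega
  obtain ⟨hidx, q, hq⟩ := index_eq_two_of_psi_lt hodd hK ha heven hlt
  obtain ⟨hout, hpsi⟩ := psi_eq_of_index_eq_two hidx hq
  have hcomm : ∀ x ∈ K, ∀ y ∈ K, x * y = y * x := fun x hx y hy => hq.mul_comm_of_mem hx hy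
  rw [hidx] at hcardG
  have hpow := pow_three_eq_one_of_sum_orderOf_lt hodd hK hcomm (by omega)
  have hord : ∀ x ∈ K, x ≠ 1 → orderOf x = 3 := fun x hx hx1 =>
    have : Fact (Nat.Prime 3) := ⟨Nat.prime_three⟩
    orderOf_eq_prime (hpow x hx) hx1
  have hsum := sum_orderOf_of_pow_three_eq_one hord
  obtain ⟨m, hm⟩ : ∃ m, Nat.card K = 3 ^ m := by
    have : Fact (Nat.Prime 3) := ⟨Nat.prime_three⟩
    refine IsPGroup.iff_card.1 (isPGroup_iff_pow_pow_eq_one.2 fun x => ⟨1, ?_⟩)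
    exact Subtype.ext (by simpa using hpow x x.2)
  refine ⟨m, K, ?_, hKn, hm, hidx, hcomm, hord, hout, ?_⟩
  · rcases m with - | m
    · rw [hm] at hK
      norm_num at hK
    · omega
  · have h5 : psi G + 2 = 5 * 3 ^ m := by omega
    have h5' : (psi G : ℚ) = 5 * 3 ^ m - 2 := by
      rw [eq_sub_iff_add_eq]
      exact_mod_cast h5
    rw [avgOrder, h5', ← hcardG, hm, mul_comm (3 ^ m) 2]
    push_cast
    rfl
end
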